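/- arXiv:1712.08358 — 8 statements merged into one kernel-verified Lean document; each statement's English description precedes it below -/
import Mathlib

section
/- Let q ≥ 1, let G ⊆ ℂ be a nonempty open connected set, and let S : G → ℂ^{q×q} be a holomorphic matrix-valued function with ‖S(z)‖ ≤ 1 (operator norm) for every z ∈ G. (a) If U ∈ ℂ^{q×q} satisfies U*U = I_q, then ker(U + S(w)) = ker(U + S(z)) for every choice of w and z in G. (b) If V ∈ ℂ^{q×q} satisfies VV* = I_q, then range(V + S(w)) = range(V + S(z)) for every choice of w and z in G. -/
open Matrix

lemma aux_ker (q : ℕ) (G : Set ℂ) (hGopen : IsOpen G) (hGconn : IsConnected G)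
    (S : ℂ → Matrix (Fin q) (Fin q) ℂ)
    (hHol : ∀ i j : Fin q, DifferentiableOn ℂ (fun z => S z i j) G)
    (hContr : ∀ z ∈ G, ∀ x : Fin q → ℂ, ‖WithLp.toLp 2 (S z *ᵥ x)‖ ≤ ‖WithLp.toLp 2 x‖)
    (U : Matrix (Fin q) (Fin q) ℂ) (hU : Uᴴ * U = 1) (w : ℂ) (hw : w ∈ G) (z : ℂ) (hz : z ∈ G)
    (x : Fin q → ℂ) (hx : (U + S w) *ᵥ x = 0) : (U + S z) *ᵥ x = 0 := by
  have h1 : S w *ᵥ x = - (U *ᵥ x) := by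
    rw [add_mulVec] at hx
    exact (neg_eq_of_add_eq_zero_right hx).symm
  have hn : ‖WithLp.toLp 2 (U *ᵥ x)‖ = ‖WithLp.toLp 2 x‖ := by
    have : star (U *ᵥ x) ⬝ᵥ (U *ᵥ x) = star x ⬝ᵥ x := by
      rw [star_mulVec, dotProduct_mulVec, vecMul_vecMul, hU, vecMul_one]
    rw [@norm_eq_sqrt_re_inner ℂ, @norm_eq_sqrt_re_inner ℂ, EuclideanSpace.inner_toLp_toLp,
      EuclideanSpace.inner_toLp_toLp, dotProduct_comm, this, dotProduct_comm]
  have hd : DifferentiableOn ℂ (fun z => WithLp.toLp 2 (S z *ᵥ x)) G := by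
    rw [differentiableOn_euclidean]
    intro i
    simp only [mulVec, dotProduct]
    exact DifferentiableOn.fun_sum fun j _ => (hHol i j).mul_const _
  have hm : IsMaxOn (norm ∘ fun z => WithLp.toLp 2 (S z *ᵥ x)) G w := by
    intro y hy
    simp only [Set.mem_ofPred_eq, Function.comp]
    rw [h1, WithLp.toLp_neg, norm_neg, hn]
    exact hContr y hy x
  have := Complex.eqOn_of_isPreconnected_of_isMaxOn_norm hGconn.isPreconnected hGopen hd hw hm hz
  have h2 : S z *ᵥ x = S w *ᵥ x := by simpa using this
  rw [add_mulVec] at hx ⊢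
  rw [h2, hx]

lemma aux_range {q : ℕ} (A B : Matrix (Fin q) (Fin q) ℂ)
    (h : ∀ x, Bᵀ *ᵥ x = 0 → Aᵀ *ᵥ x = 0) :
    LinearMap.range A.mulVecLin ≤ LinearMap.range B.mulVecLin := by
  rintro _ ⟨y, rfl⟩
  by_contra hy
  obtain ⟨f, hf, hf'⟩ := Submodule.exists_le_ker_of_notMem hy
  obtain ⟨v, rfl⟩ := (dotProductEquiv ℂ (Fin q)).surjective f
  have hB : Bᵀ *ᵥ v = 0 := by
    rw [mulVec_transpose]
    apply dotProduct_eq_zero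
    intro u
    rw [← dotProduct_mulVec]
    exact hf' ⟨u, rfl⟩
  apply hf
  have := h v hB
  rw [mulVec_transpose] at this
  simp [dotProduct_mulVec, this]

/-- Lemma (TS417): if `S` is a `q×q` Schur function on a region `G` of `ℂ` (holomorphic and
contractive in the operator norm), then (a) for an isometry `U` (`U*U = I`) the kernel of
`U + S(z)` does not depend on `z ∈ G`, and (b) for a coisometry `V` (`VV* = I`) the range of
`V + S(z)` does not depend on `z ∈ G`. -/
theorem schur_function_const_ker_and_range
    (q : ℕ) (hq : 1 ≤ q) (G : Set ℂ) (hGopen : IsOpen G) (hGconn : IsConnected G)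
    (S : ℂ → Matrix (Fin q) (Fin q) ℂ)
    (hHol : ∀ i j : Fin q, DifferentiableOn ℂ (fun z => S z i j) G)
    (hContr : ∀ z ∈ G, ‖Matrix.toEuclideanCLM (𝕜 := ℂ) (S z)‖ ≤ 1) :
    (∀ U : Matrix (Fin q) (Fin q) ℂ, Uᴴ * U = 1 →
      ∀ w ∈ G, ∀ z ∈ G,
        LinearMap.ker (Matrix.mulVecLin (U + S w)) =
          LinearMap.ker (Matrix.mulVecLin (U + S z))) ∧
    (∀ V : Matrix (Fin q) (Fin q) ℂ, V * Vᴴ = 1 →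
      ∀ w ∈ G, ∀ z ∈ G,
        LinearMap.range (Matrix.mulVecLin (V + S w)) =
          LinearMap.range (Matrix.mulVecLin (V + S z))) := by
  have hc : ∀ z ∈ G, ∀ x : Fin q → ℂ, ‖WithLp.toLp 2 (S z *ᵥ x)‖ ≤ ‖WithLp.toLp 2 x‖ := by
    intro z hz x
    have := (Matrix.toEuclideanCLM (𝕜 := ℂ) (S z)).le_of_opNorm_le (hContr z hz) (WithLp.toLp 2 x)
    simpa using this
  have hs : ∀ x : Fin q → ℂ, ‖WithLp.toLp 2 (star x)‖ = ‖WithLp.toLp 2 x‖ := by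
    intro x
    simp [EuclideanSpace.norm_eq]
  have hcT : ∀ z ∈ G, ∀ x : Fin q → ℂ, ‖WithLp.toLp 2 ((S z)ᵀ *ᵥ x)‖ ≤ ‖WithLp.toLp 2 x‖ := by
    intro z hz x
    have h1 : ‖Matrix.toEuclideanCLM (𝕜 := ℂ) (S z)ᴴ‖ ≤ 1 := by
      rw [← star_eq_conjTranspose, map_star, ContinuousLinearMap.star_eq_adjoint]
      exact (LinearIsometryEquiv.norm_map ContinuousLinearMap.adjoint _).trans_le (hContr z hz)
    have := (Matrix.toEuclideanCLM (𝕜 := ℂ) (S z)ᴴ).le_of_opNorm_le h1 (WithLp.toLp 2 (star x))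
    rw [hs, one_mul, toEuclideanCLM_toLp, ← hs, star_mulVec, conjTranspose_conjTranspose,
      star_star] at this
    rw [mulVec_transpose]
    exact this
  constructor
  · intro U hU w hw z hz
    ext x
    exact ⟨aux_ker q G hGopen hGconn S hHol hc U hU w hw z hz x,
      aux_ker q G hGopen hGconn S hHol hc U hU z hz w hw x⟩
  · intro V hV
    have hVT : (Vᵀ)ᴴ * Vᵀ = 1 := by
      have := congrArg Matrix.transpose hV
      rw [transpose_mul, transpose_one] at this
      exact this
    have key : ∀ w ∈ G, ∀ z ∈ G, LinearMap.range (Matrix.mulVecLin (V + S w)) ≤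
          LinearMap.range (Matrix.mulVecLin (V + S z)) := by
      intro w hw z hz
      apply aux_range
      intro x hx
      rw [transpose_add] at hx ⊢
      exact aux_ker q G hGopen hGconn (fun z => (S z)ᵀ) (fun i j => hHol j i) hcT Vᵀ hVT
        z hz w hw x hx
    exact fun w hw z hz => le_antisymm (key w hw z hz) (key z hz w hw)
end

section
/- Let q ≥ 1, α ∈ ℝ, κ ∈ ℕ₀, and let (s_j)_{j=0}^{κ} be Hermitian complex q×q matrices. Let G ⊆ ℂ with G∖ℝ ≠ ∅, let f : G → ℂ^{q×q} be any matrix-valued function, let G∨ := {z ∈ ℂ : conj(z) ∈ G}, and define f∨ : G∨ → ℂ^{q×q} by f∨(z) := f(conj(z))*. Then for each k ∈ {−1, 0, …, κ} and each z ∈ G∨∖ℝ there exists a complex (m_k+2)q × (m_k+2)q matrix X_k(z) such that P_k^{[f∨]}(z) = X_k(z) · P_k^{[f]}(conj(z)) · X_k(z)*. -/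
open Matrix ComplexConjugate

noncomputable section

/-- The block Hankel matrix `H_n = [s_{j+k}]_{j,k=0}^n`. -/
def hank (q n : ℕ) (s : ℕ → Matrix (Fin q) (Fin q) ℂ) :
    Matrix (Fin (n + 1) × Fin q) (Fin (n + 1) × Fin q) ℂ :=
  Matrix.of fun j k => s (j.1.val + k.1.val) j.2 k.2

/-- The right-sided `α`-shifted sequence `s_{α▷j} = -α·s_j + s_{j+1}`. -/
def sShift {q : ℕ} (α : ℝ) (s : ℕ → Matrix (Fin q) (Fin q) ℂ) :
    ℕ → Matrix (Fin q) (Fin q) ℂ :=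
  fun j => (-(α : ℂ)) • s j + s (j + 1)

/-- The block shift `T_{q,n} = [δ_{j,k+1}·I_q]_{j,k=0}^n`. -/
def bshift (q n : ℕ) : Matrix (Fin (n + 1) × Fin q) (Fin (n + 1) × Fin q) ℂ :=
  Matrix.of fun j k => if j.1.val = k.1.val + 1 ∧ j.2 = k.2 then (1 : ℂ) else 0

/-- `v_{q,n} = col(δ_{j,0}·I_q)_{j=0}^n`. -/
def vq (q n : ℕ) : Matrix (Fin (n + 1) × Fin q) (Fin q) ℂ :=
  Matrix.of fun j b => if j.1.val = 0 ∧ j.2 = b then (1 : ℂ) else 0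

/-- `u_n = -col(s_{j-1})_{j=0}^n` with `s_{-1} = 0`. -/
def uq (q n : ℕ) (s : ℕ → Matrix (Fin q) (Fin q) ℂ) :
    Matrix (Fin (n + 1) × Fin q) (Fin q) ℂ :=
  Matrix.of fun j b => if j.1.val = 0 then 0 else -s (j.1.val - 1) j.2 b

/-- `y_{0,n} = col(s_j)_{j=0}^n`. -/
def yq (q n : ℕ) (s : ℕ → Matrix (Fin q) (Fin q) ℂ) :
    Matrix (Fin (n + 1) × Fin q) (Fin q) ℂ :=
  Matrix.of fun j b => s j.1.val j.2 b

/-- `R_T(z) = (I - z·T_{q,n})⁻¹`. -/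
def RT (q n : ℕ) (z : ℂ) : Matrix (Fin (n + 1) × Fin q) (Fin (n + 1) × Fin q) ℂ :=
  (1 - z • bshift q n)⁻¹

/-- The Potapov fundamental matrix `P_{2n}^{[f]}(z)`. -/
def Peven (q n : ℕ) (s : ℕ → Matrix (Fin q) (Fin q) ℂ)
    (f : ℂ → Matrix (Fin q) (Fin q) ℂ) (z : ℂ) :
    Matrix ((Fin (n + 1) × Fin q) ⊕ Fin q) ((Fin (n + 1) × Fin q) ⊕ Fin q) ℂ :=
  Matrix.fromBlocks (hank q n s)
    (RT q n z * (vq q n * f z - uq q n s))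
    (RT q n z * (vq q n * f z - uq q n s))ᴴ
    ((z - conj z)⁻¹ • (f z - (f z)ᴴ))

/-- The Potapov fundamental matrix `P_{2n+1}^{[f]}(z)`. -/
def Podd (q n : ℕ) (α : ℝ) (s : ℕ → Matrix (Fin q) (Fin q) ℂ)
    (f : ℂ → Matrix (Fin q) (Fin q) ℂ) (z : ℂ) :
    Matrix ((Fin (n + 1) × Fin q) ⊕ Fin q) ((Fin (n + 1) × Fin q) ⊕ Fin q) ℂ :=
  Matrix.fromBlocks (hank q n (sShift α s))
    (RT q n z * (vq q n * ((z - (α : ℂ)) • f z) - ((-(α : ℂ)) • uq q n s - yq q n s)))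
    (RT q n z * (vq q n * ((z - (α : ℂ)) • f z) - ((-(α : ℂ)) • uq q n s - yq q n s)))ᴴ
    ((z - conj z)⁻¹ • ((z - (α : ℂ)) • f z - ((z - (α : ℂ)) • f z)ᴴ))

/-- The Potapov fundamental matrix `P_{-1}^{[f]}(z)`. -/
def Pneg (q : ℕ) (α : ℝ) (f : ℂ → Matrix (Fin q) (Fin q) ℂ) (z : ℂ) :
    Matrix (Fin q) (Fin q) ℂ :=
  (z - conj z)⁻¹ • ((z - (α : ℂ)) • f z - ((z - (α : ℂ)) • f z)ᴴ)

end

theorem bshift_pow_apply (q n m : ℕ) (j k : Fin (n + 1) × Fin q) (h : j.1.val < m) :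
    (bshift q n ^ m) j k = 0 := by
  induction m generalizing j with
  | zero => omega
  | succ m ih =>
    rw [pow_succ', Matrix.mul_apply]
    refine Finset.sum_eq_zero fun l _ => ?_
    by_cases hl : j.1.val = l.1.val + 1 ∧ j.2 = l.2
    · rw [ih l (by omega), mul_zero]
    · simp [bshift, hl]

theorem isUnit_one_sub_bshift (q n : ℕ) (z : ℂ) : IsUnit (1 - z • bshift q n).det := by
  rw [← Matrix.isUnit_iff_isUnit_det]
  apply IsNilpotent.isUnit_one_sub
  refine ⟨n + 1, ?_⟩
  rw [smul_pow]
  have : bshift q n ^ (n + 1) = 0 := by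
    ext j k
    exact bshift_pow_apply q n (n + 1) j k j.1.isLt
  rw [this, smul_zero]

theorem key {m p : Type*} [Fintype m] [DecidableEq m] [Fintype p] [DecidableEq p]
    (T H : Matrix m m ℂ) (v u : Matrix m p ℂ) (F : Matrix p p ℂ) (z : ℂ) (hz : z.im ≠ 0)
    (h1 : IsUnit (1 - z • T).det) (h2 : IsUnit (1 - conj z • T).det)
    (hL : T * H - H * Tᴴ = v * uᴴ - u * vᴴ) :
    ∃ X : Matrix (m ⊕ p) (m ⊕ p) ℂ,
      Matrix.fromBlocks H ((1 - z • T)⁻¹ * (v * Fᴴ - u)) ((1 - z • T)⁻¹ * (v * Fᴴ - u))ᴴ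
        ((z - conj z)⁻¹ • (Fᴴ - F)) =
      X * Matrix.fromBlocks H ((1 - conj z • T)⁻¹ * (v * F - u))
        ((1 - conj z • T)⁻¹ * (v * F - u))ᴴ ((conj z - z)⁻¹ • (F - Fᴴ)) * Xᴴ := by
  have hzw : conj z - z ≠ 0 := by
    intro h
    apply hz
    have := congrArg Complex.im h
    simp at this
    linarith
  set w := conj z with hw
  have hC : (z - w)⁻¹ • (Fᴴ - F) = (w - z)⁻¹ • (F - Fᴴ) := by
    rw [← neg_sub w z, ← neg_sub F, inv_neg, neg_smul_neg]
  rw [hC]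
  set M := 1 - z • T with hM
  set N := 1 - w • T with hN
  set C := (w - z)⁻¹ • (F - Fᴴ) with hCd
  have hCF : F - Fᴴ = (w - z) • C := by rw [hCd, smul_smul, mul_inv_cancel₀ hzw, one_smul]
  have hCh : Cᴴ = C := by
    conv_rhs => rw [← hC]
    rw [hCd, conjTranspose_smul, conjTranspose_sub, conjTranspose_conjTranspose]
    congr 1
    simp [hw]
  have hMM : M * M⁻¹ = 1 := Matrix.mul_nonsing_inv _ h1
  have hMM' : M⁻¹ * M = 1 := Matrix.nonsing_inv_mul _ h1
  have hNN : N * N⁻¹ = 1 := Matrix.mul_nonsing_inv _ h2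
  have hMMs : (M⁻¹)ᴴ * Mᴴ = 1 := by rw [← conjTranspose_mul, hMM, conjTranspose_one]
  have hMMs' : Mᴴ * (M⁻¹)ᴴ = 1 := by rw [← conjTranspose_mul, hMM', conjTranspose_one]
  set B := N⁻¹ * (v * F - u) with hB
  have hNB : N * B = v * F - u := by rw [hB, ← Matrix.mul_assoc, hNN, Matrix.one_mul]
  have hBN : Bᴴ * Nᴴ = Fᴴ * vᴴ - uᴴ := by
    rw [← conjTranspose_mul, hNB, conjTranspose_sub, conjTranspose_mul]
  -- upper-right block
  have hUR : M⁻¹ * (v * Fᴴ - u) = M⁻¹ * N * B + ((z - w) • (M⁻¹ * v)) * C := by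
    rw [Matrix.mul_assoc, hNB, Matrix.smul_mul, Matrix.mul_assoc, ← Matrix.mul_smul,
      ← Matrix.mul_smul, ← Matrix.mul_add]
    congr 1
    have : (z - w) • C = Fᴴ - F := by rw [← neg_sub w z, neg_smul, ← hCF, neg_sub]
    rw [this, Matrix.mul_sub]
    abel
  have hcore : M * H * Mᴴ = N * H * Nᴴ + (z - w) • (v * (Fᴴ * vᴴ - uᴴ))
      + (w - z) • ((v * F - u) * vᴴ) + ((z - w) * (w - z)) • (v * C * vᴴ) := by
    have e1 : ((z - w) * (w - z)) • (v * C * vᴴ) = (z - w) • (v * (F - Fᴴ) * vᴴ) := by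
      rw [hCF, Matrix.mul_smul v (w - z) C, Matrix.smul_mul (w - z) (v * C), smul_smul (z - w) (w - z)]
    have hMs : Mᴴ = 1 - w • Tᴴ := by
      rw [hM, conjTranspose_sub, conjTranspose_one, conjTranspose_smul]; rfl
    have hNs : Nᴴ = 1 - z • Tᴴ := by
      rw [hN, conjTranspose_sub, conjTranspose_one, conjTranspose_smul]
      simp [hw]
    have e2 : M * H * Mᴴ = N * H * Nᴴ + (w - z) • (T * H - H * Tᴴ) := by
      rw [hMs, hNs, hM, hN]
      simp only [Matrix.sub_mul, Matrix.mul_sub, Matrix.one_mul, Matrix.mul_one,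
        Matrix.smul_mul, Matrix.mul_smul, Matrix.mul_assoc]
      module
    rw [e1, e2, hL]
    simp only [Matrix.sub_mul, Matrix.mul_sub, Matrix.mul_assoc]
    module
  have hUL : H = M⁻¹ * (M * H * Mᴴ) * (M⁻¹)ᴴ := by
    rw [Matrix.mul_assoc, Matrix.mul_assoc, Matrix.mul_assoc, hMMs', Matrix.mul_one,
      ← Matrix.mul_assoc, hMM', Matrix.one_mul]
  refine ⟨Matrix.fromBlocks (M⁻¹ * N) ((z - w) • (M⁻¹ * v)) 0 1, ?_⟩
  rw [Matrix.fromBlocks_conjTranspose, Matrix.fromBlocks_multiply, Matrix.fromBlocks_multiply]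
  simp only [Matrix.zero_mul, Matrix.mul_zero, Matrix.one_mul, Matrix.mul_one, zero_add, add_zero,
    conjTranspose_one, conjTranspose_zero]
  congr 1
  · have hD : ((z - w) • (M⁻¹ * v))ᴴ = (w - z) • (vᴴ * (M⁻¹)ᴴ) := by
      rw [conjTranspose_smul, conjTranspose_mul]
      simp [hw]
    rw [hD, conjTranspose_mul M⁻¹ N]
    conv_lhs => rw [hUL, hcore, ← hBN, ← hNB]
    simp only [Matrix.add_mul, Matrix.mul_add, Matrix.mul_assoc, Matrix.smul_mul, Matrix.mul_smul]
    module
  · rw [hUR, conjTranspose_add, conjTranspose_mul _ B, conjTranspose_mul _ C, hCh]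

theorem hank_lyap (q n : ℕ) (s : ℕ → Matrix (Fin q) (Fin q) ℂ) (U : Matrix (Fin (n+1) × Fin q) (Fin q) ℂ)
    (a : Matrix (Fin q) (Fin q) ℂ) (ha : aᴴ = a)
    (hs : ∀ j < n, (s j)ᴴ = s j)
    (hU : ∀ j b, U j b = if j.1.val = 0 then a j.2 b else - s (j.1.val - 1) j.2 b) :
    bshift q n * hank q n s - hank q n s * (bshift q n)ᴴ = vq q n * Uᴴ - U * (vq q n)ᴴ := by
  have hT : ∀ j k, (bshift q n * hank q n s) j k =
      if j.1.val = 0 then 0 else s (j.1.val - 1 + k.1.val) j.2 k.2 := by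
    rintro ⟨j, a⟩ ⟨k, b⟩
    rw [Matrix.mul_apply]
    split_ifs with h
    · refine Finset.sum_eq_zero fun l _ => ?_
      have : ¬ (j.val = l.1.val + 1 ∧ a = l.2) := by simp at h; simp [h]
      simp [bshift, this]
    · have hj := j.isLt
      simp only at h
      rw [Finset.sum_eq_single (⟨⟨j.val - 1, by omega⟩, a⟩ : Fin (n+1) × Fin q)]
      · have : j.val = j.val - 1 + 1 := by omega
        simp [bshift, hank, ← this]
      · rintro ⟨l, c⟩ _ hl
        have : ¬ (j.val = l.val + 1 ∧ a = c) := by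
          rintro ⟨h1, h2⟩
          apply hl
          ext <;> simp [h1, h2]
        simp [bshift, this]
      · simp
  have hT' : ∀ j k, (hank q n s * (bshift q n)ᴴ) j k =
      if k.1.val = 0 then 0 else s (k.1.val - 1 + j.1.val) j.2 k.2 := by
    rintro ⟨k, b⟩ ⟨j, a⟩
    rw [Matrix.mul_apply]
    split_ifs with h
    · refine Finset.sum_eq_zero fun l _ => ?_
      have : ¬ (j.val = l.1.val + 1 ∧ a = l.2) := by simp at h; simp [h]
      simp [bshift, this]
    · have hj := j.isLt
      simp only at h
      rw [Finset.sum_eq_single (⟨⟨j.val - 1, by omega⟩, a⟩ : Fin (n+1) × Fin q)]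
      · have : j.val = j.val - 1 + 1 := by omega
        simp [bshift, hank, ← this, add_comm]
      · rintro ⟨l, c⟩ _ hl
        have : ¬ (j.val = l.val + 1 ∧ a = c) := by
          rintro ⟨h1, h2⟩
          apply hl
          ext <;> simp [h1, h2]
        simp [bshift, this]
      · simp
  have hv : ∀ j k, (vq q n * Uᴴ) j k = if j.1.val = 0 then star (U k j.2) else 0 := by
    intro j k
    rw [Matrix.mul_apply]
    by_cases h : j.1.val = 0
    · have h0 : j.1 = 0 := Fin.ext h
      simp [vq, h0]
    · have h0 : j.1 ≠ 0 := fun e => h (by rw [e]; rfl)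
      simp [vq, h0]
  have hv' : ∀ j k, (U * (vq q n)ᴴ) j k = if k.1.val = 0 then U j k.2 else 0 := by
    intro j k
    rw [Matrix.mul_apply]
    by_cases h : k.1.val = 0
    · have h0 : k.1 = 0 := Fin.ext h
      simp [vq, h0, apply_ite]
    · have h0 : k.1 ≠ 0 := fun e => h (by rw [e]; rfl)
      simp [vq, h0]
  have hh : ∀ j < n, ∀ a b, star (s j a b) = s j b a := fun j hj a b => by
    conv_rhs => rw [← hs j hj]
    rfl
  have hh' : ∀ c b, star (a c b) = a b c := fun c b => by
    conv_rhs => rw [← ha]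
    rfl
  ext j k
  rw [Matrix.sub_apply, Matrix.sub_apply, hT, hT', hv, hv', hU, hU]
  have hj := j.1.isLt
  have hk := k.1.isLt
  by_cases h1 : j.1.val = 0 <;> by_cases h2 : k.1.val = 0
  · simp only [h1, h2, if_true, hh']
    ring
  · simp only [h1, h2, if_true, if_false, star_neg, hh _ (show k.1.val - 1 < n by omega)]
    simp
  · simp only [h1, h2, if_true, if_false]
    simp
  · simp only [h1, h2, if_false]
    rw [show j.1.val - 1 + k.1.val = k.1.val - 1 + j.1.val by omega]
    ring

/-- Lemma (MP36N): for Hermitian data `(s_j)_{j=0}^κ` and `f∨(z) := f(conj z)*`, each Potapov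
fundamental matrix of `f∨` at `z` is congruent to the corresponding one of `f` at `conj z`. -/
theorem potapov_matrices_of_conjugate_function_congruent
    (q : ℕ) (hq : 1 ≤ q) (α : ℝ) (κ : ℕ)
    (s : ℕ → Matrix (Fin q) (Fin q) ℂ) (hs : ∀ j ≤ κ, (s j)ᴴ = s j)
    (G : Set ℂ) (hG : ∃ z ∈ G, z.im ≠ 0)
    (f : ℂ → Matrix (Fin q) (Fin q) ℂ) :
    (∀ z : ℂ, conj z ∈ G → z.im ≠ 0 →
      ∃ X : Matrix (Fin q) (Fin q) ℂ,
        Pneg q α (fun w => (f (conj w))ᴴ) z = X * Pneg q α f (conj z) * Xᴴ) ∧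
    (∀ n : ℕ, 2 * n ≤ κ → ∀ z : ℂ, conj z ∈ G → z.im ≠ 0 →
      ∃ X : Matrix ((Fin (n + 1) × Fin q) ⊕ Fin q) ((Fin (n + 1) × Fin q) ⊕ Fin q) ℂ,
        Peven q n s (fun w => (f (conj w))ᴴ) z = X * Peven q n s f (conj z) * Xᴴ) ∧
    (∀ n : ℕ, 2 * n + 1 ≤ κ → ∀ z : ℂ, conj z ∈ G → z.im ≠ 0 →
      ∃ X : Matrix ((Fin (n + 1) × Fin q) ⊕ Fin q) ((Fin (n + 1) × Fin q) ⊕ Fin q) ℂ,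
        Podd q n α s (fun w => (f (conj w))ᴴ) z = X * Podd q n α s f (conj z) * Xᴴ) := by
  refine ⟨fun z _ hz => ⟨1, ?_⟩, fun n hn z _ hz => ?_, fun n hn z _ hz => ?_⟩
  · rw [conjTranspose_one, Matrix.one_mul, Matrix.mul_one]
    simp only [Pneg, conjTranspose_smul, conjTranspose_conjTranspose, Complex.conj_conj]
    have e1 : star (z - (α : ℂ)) = conj z - (α : ℂ) := by simp
    have e2 : star (conj z - (α : ℂ)) = z - (α : ℂ) := by simp
    rw [e1, e2, ← neg_sub (conj z) z, inv_neg, neg_smul, ← smul_neg, neg_sub]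
  · have := key (bshift q n) (hank q n s) (vq q n) (uq q n s) (f (conj z)) z hz
      (isUnit_one_sub_bshift q n z) (isUnit_one_sub_bshift q n _)
      (hank_lyap q n s _ 0 (by simp) (fun j hj => hs j (by omega)) (fun j b => by simp [uq]))
    simpa only [Peven, RT, conjTranspose_conjTranspose, Complex.conj_conj] using this
  · have := key (bshift q n) (hank q n (sShift α s)) (vq q n)
      ((-(α : ℂ)) • uq q n s - yq q n s) ((conj z - (α : ℂ)) • f (conj z)) z hz
      (isUnit_one_sub_bshift q n z) (isUnit_one_sub_bshift q n _)
      (hank_lyap q n (sShift α s) _ (-s 0) (by rw [conjTranspose_neg, hs 0 (by omega)])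
        (fun j hj => by
          simp [sShift, conjTranspose_add, conjTranspose_smul, hs j (by omega),
            hs (j+1) (by omega)])
        (fun j b => by
          by_cases h : j.1.val = 0
          · have h0 : j.1 = 0 := Fin.ext h
            simp [uq, yq, h0]
          · have h' : j.1.val - 1 + 1 = j.1.val := by omega
            have h0 : j.1 ≠ 0 := fun e => h (by rw [e]; rfl)
            simp [uq, yq, h0, sShift, h']
            ring))
    have e : ((conj z - (α : ℂ)) • f (conj z))ᴴ = (z - (α : ℂ)) • (f (conj z))ᴴ := by
      rw [conjTranspose_smul]; simp
    have e' : ((z - (α : ℂ)) • (f (conj z))ᴴ)ᴴ = (conj z - (α : ℂ)) • f (conj z) := by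
      rw [← e, conjTranspose_conjTranspose]
    simpa only [Podd, RT, e, e', Complex.conj_conj] using this
end

section
/- Let α ∈ ℝ, A ∈ ℝ, B ∈ [0,∞), let ν be a finite positive Borel measure on ℝ, let μ(E) := ∫_E (1+t²) ν(dt), and define F : ℍ → ℂ by F(w) := A + B·w + ∫_ℝ (1+t·w)/(t−w) ν(dt), and F^#(w) := (w−α)·F(w). Then for every w ∈ ℍ the function g_w(t) := t·(|t−w|^{−2} − (1+t²)^{−1}) − α·|t−w|^{−2} satisfies ∫_ℝ |g_w(t)| μ(dt) < ∞, and Im F^#(w) = (Im w)·(A + B·(2·Re w − α) + ∫_ℝ g_w(t) μ(dt)). -/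
open MeasureTheory

/-- Lemma (MB2210 (b)): for a scalar Herglotz–Nevanlinna function
`F(w) = A + B·w + ∫ (1+tw)/(t-w) ν(dt)` with spectral measure
`μ(E) = ∫_E (1+t²) ν(dt)` and `F^#(w) = (w-α)·F(w)`, the function
`g_w(t) = t·(|t-w|⁻² - (1+t²)⁻¹) - α·|t-w|⁻²` is `μ`-integrable for every `w` in the upper
half-plane and `Im F^#(w) = (Im w)·(A + B·(2·Re w - α) + ∫ g_w dμ)`. -/
theorem herglotz_shifted_im_eq_spectral_integral
    (α A B : ℝ) (hB : 0 ≤ B) (ν : Measure ℝ) [IsFiniteMeasure ν] :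
    ∀ w : ℂ, 0 < w.im →
      Integrable
        (fun t : ℝ =>
          t * ((Complex.normSq ((t : ℂ) - w))⁻¹ - (1 + t ^ 2)⁻¹) -
            α * (Complex.normSq ((t : ℂ) - w))⁻¹)
        (ν.withDensity fun t => ENNReal.ofReal (1 + t ^ 2)) ∧
      ((w - (α : ℂ)) *
            ((A : ℂ) + (B : ℂ) * w + ∫ t : ℝ, (1 + (t : ℂ) * w) / ((t : ℂ) - w) ∂ν)).im =
        w.im * (A + B * (2 * w.re - α) +
          ∫ t : ℝ,
            (t * ((Complex.normSq ((t : ℂ) - w))⁻¹ - (1 + t ^ 2)⁻¹) -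
              α * (Complex.normSq ((t : ℂ) - w))⁻¹)
            ∂(ν.withDensity fun t => ENNReal.ofReal (1 + t ^ 2))) := by
  intro w hw
  have hne : ∀ t : ℝ, (t : ℂ) - w ≠ 0 := by
    intro t h
    have := congrArg Complex.im h
    simp at this
    exact hw.ne' this
  have hK : Integrable (fun t : ℝ => (1 + (t : ℂ) * w) / ((t : ℂ) - w)) ν := by
    have hc : Continuous (fun t : ℝ => (1 + (t : ℂ) * w) / ((t : ℂ) - w)) :=
      Continuous.div (by fun_prop) (by fun_prop) hne
    refine Integrable.of_bound hc.aestronglyMeasurable (‖w‖ + ‖1 + w ^ 2‖ / w.im) ?_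
    refine Filter.Eventually.of_forall fun t => ?_
    have e : (1 + (t : ℂ) * w) / ((t : ℂ) - w) = w + (1 + w ^ 2) / ((t : ℂ) - w) := by
      have := hne t
      field_simp
      ring
    rw [e]
    refine (norm_add_le _ _).trans ?_
    rw [norm_div]
    have h1 : w.im ≤ ‖(t : ℂ) - w‖ := by
      have := Complex.abs_im_le_norm ((t : ℂ) - w)
      simp at this
      exact (le_abs_self _).trans this
    gcongr
  have hJ := hK.const_mul (w - (α : ℂ))
  have hpt : ∀ t : ℝ, (1 + t ^ 2) * (t * ((Complex.normSq ((t : ℂ) - w))⁻¹ - (1 + t ^ 2)⁻¹) -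
            α * (Complex.normSq ((t : ℂ) - w))⁻¹) =
      w.im⁻¹ * ((w - (α : ℂ)) * ((1 + (t : ℂ) * w) / ((t : ℂ) - w))).im := by
    intro t
    have hN : Complex.normSq ((t : ℂ) - w) ≠ 0 := by simpa using hne t
    have h1 : (1 + t ^ 2) ≠ 0 := by positivity
    have hy := hw.ne'
    rw [Complex.mul_im, Complex.div_re, Complex.div_im]
    have hNe : Complex.normSq ((t : ℂ) - w) = (t - w.re) * (t - w.re) + w.im * w.im := by
      simp [Complex.normSq_apply]
    generalize Complex.normSq ((t : ℂ) - w) = N at *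
    simp
    field_simp
    rw [hNe]
    ring
  have hm : Measurable (fun t : ℝ => ENNReal.ofReal (1 + t ^ 2)) := by fun_prop
  have hfin : ∀ᵐ t : ℝ ∂ν, ENNReal.ofReal (1 + t ^ 2) < ⊤ := by simp
  have htr : ∀ t : ℝ, (ENNReal.ofReal (1 + t ^ 2)).toReal = 1 + t ^ 2 := fun t =>
    ENNReal.toReal_ofReal (by positivity)
  have him := hJ.im
  constructor
  · rw [integrable_withDensity_iff_integrable_smul' hm hfin]
    simp only [htr, smul_eq_mul, hpt]
    exact him.const_mul _
  · rw [integral_withDensity_eq_integral_toReal_smul hm hfin]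
    simp only [htr, smul_eq_mul, hpt]
    rw [integral_const_mul]
    have e := integral_im hJ
    change ∫ t : ℝ, ((w - (α : ℂ)) * ((1 + (t : ℂ) * w) / ((t : ℂ) - w))).im ∂ν = Complex.im _ at e
    rw [e, integral_const_mul, mul_add, Complex.add_im, mul_add w.im, mul_inv_cancel_left₀ hw.ne']
    congr 1
    simp
    ring
end

section
/- Let α ∈ ℝ, A ∈ ℝ, B ∈ [0,∞), let ν be a finite positive Borel measure on ℝ, and define F : ℍ → ℂ by F(w) := A + B·w + ∫_ℝ (1+t·w)/(t−w) ν(dt). Assume that Im((w−α)·F(w)) ≥ 0 for every w ∈ ℍ. Then ν((−∞,α)) = 0 and μ((−∞,α)) = 0, where μ(E) := ∫_E (1+t²) ν(dt). -/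
open MeasureTheory

lemma aux_kernel (α x y t : ℝ) (hy : 0 < y) :
    (((⟨x, y⟩ : ℂ) - (α : ℂ)) * ((1 + (t : ℂ) * ⟨x, y⟩) / ((t : ℂ) - ⟨x, y⟩))).im
      = y * ((1 + t ^ 2) * (t - α) / ((t - x) ^ 2 + y ^ 2) - t) := by
  have h : (t - x) ^ 2 + y ^ 2 ≠ 0 := by positivity
  have h' : (t - x) * (t - x) + y * y ≠ 0 := by
    intro h0; apply h; linarith
  simp only [Complex.mul_im, Complex.div_im, Complex.div_re, Complex.normSq_apply, Complex.sub_re,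
    Complex.sub_im, Complex.add_re, Complex.add_im, Complex.mul_re, Complex.ofReal_re,
    Complex.ofReal_im, Complex.one_re, Complex.one_im]
  have e : (t - x) * (t - x) + (0 - y) * (0 - y) = (t - x) ^ 2 + y ^ 2 := by ring
  rw [e]
  field_simp
  ring

lemma aux_bound (α x y t R η : ℝ) (hy : 0 < y) (hy1 : y ≤ η) (hη : 0 < η) (hη1 : η ≤ 1)
    (hd : 2 * η ≤ α - x) (hR : |x| ≤ R) :
    (1 + t ^ 2) * (t - α) / ((t - x) ^ 2 + y ^ 2) - t ≤
      ((2 + R ^ 2) / η + R + 1) - (Set.Icc (x - y) (x + y)).indicator (fun _ => η / (2 * y ^ 2)) t := by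
  have hpos : 0 < (t - x) ^ 2 + y ^ 2 := by positivity
  have hR0 : 0 ≤ R := (abs_nonneg x).trans hR
  obtain ⟨hx1, hx2⟩ := abs_le.mp hR
  have hC : 0 ≤ (2 + R ^ 2) / η := by positivity
  by_cases hmem : t ∈ Set.Icc (x - y) (x + y)
  · rw [Set.indicator_of_mem hmem]
    obtain ⟨h1, h2⟩ := hmem
    have h3 : (1 + t ^ 2) * (t - α) / ((t - x) ^ 2 + y ^ 2) ≤ - (η / (2 * y ^ 2)) := by
      rw [← neg_div, div_le_div_iff₀ hpos (by positivity)]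
      have h4 : (t - x) ^ 2 ≤ y ^ 2 := by nlinarith
      have h5 : (1 + t ^ 2) * (t - α) ≤ - η := by nlinarith [sq_nonneg t]
      nlinarith [mul_le_mul_of_nonneg_right h5 (by positivity : 0 ≤ 2 * y ^ 2)]
    linarith
  · rw [Set.indicator_of_notMem hmem, sub_zero]
    by_cases hs : |t - x| < η
    · obtain ⟨h1, h2⟩ := abs_lt.mp hs
      have h3 : (1 + t ^ 2) * (t - α) / ((t - x) ^ 2 + y ^ 2) ≤ 0 := by
        apply div_nonpos_of_nonpos_of_nonneg _ hpos.le
        apply mul_nonpos_of_nonneg_of_nonpos (by positivity) (by linarith)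
      linarith
    · push Not at hs
      rw [sub_le_iff_le_add, div_le_iff₀ hpos]
      obtain ⟨s, rfl⟩ : ∃ s, t = x + s := ⟨t - x, by ring⟩
      have e : x + s - x = s := by ring
      rw [e] at hs hpos ⊢
      have hss : |s| ≤ s ^ 2 / η := by
        rw [le_div_iff₀ hη, ← sq_abs]; nlinarith [abs_nonneg s]
      have hx2' : x ^ 2 ≤ R ^ 2 := by nlinarith
      have hy2 : y ^ 2 ≤ 1 := by nlinarith
      have a1 : s * (1 + x ^ 2 - y ^ 2) ≤ (2 + R ^ 2) / η * s ^ 2 := by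
        calc s * (1 + x ^ 2 - y ^ 2) ≤ |s| * (2 + R ^ 2) := by
              apply mul_le_mul (le_abs_self s) _ _ (abs_nonneg s) <;> nlinarith
          _ ≤ s ^ 2 / η * (2 + R ^ 2) := by gcongr
          _ = _ := by ring
      have a2 : x * s ^ 2 ≤ R * s ^ 2 := by gcongr
      have a3 : - x * y ^ 2 ≤ R * y ^ 2 := by
        apply mul_le_mul_of_nonneg_right _ (by positivity); linarith
      have a4 : 0 ≤ (α - x) * (1 + (x + s) ^ 2) := mul_nonneg (by linarith) (by positivity)
      have a5 : 0 ≤ (2 + R ^ 2) / η * y ^ 2 := by positivity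
      nlinarith [sq_nonneg s, sq_nonneg y]

lemma aux_integrable (ν : Measure ℝ) [IsFiniteMeasure ν] (w : ℂ) (hw : 0 < w.im) :
    Integrable (fun t : ℝ => (1 + (t : ℂ) * w) / ((t : ℂ) - w)) ν := by
  have hlow : ∀ t : ℝ, w.im ≤ ‖(t : ℂ) - w‖ := fun t => by
    have := Complex.abs_im_le_norm ((t : ℂ) - w)
    simp only [Complex.sub_im, Complex.ofReal_im, zero_sub, abs_neg] at this
    exact (le_abs_self _).trans this
  have hne : ∀ t : ℝ, (t : ℂ) - w ≠ 0 := fun t => norm_pos_iff.mp (hw.trans_le (hlow t))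
  have hc : Continuous (fun t : ℝ => (1 + (t : ℂ) * w) / ((t : ℂ) - w)) := by
    apply Continuous.div₀ (by fun_prop) (by fun_prop) hne
  refine Integrable.of_bound hc.aestronglyMeasurable ((1 + ‖w‖ ^ 2) / w.im + ‖w‖) (ae_of_all _ ?_)
  intro t
  have e : (1 + (t : ℂ) * w) / ((t : ℂ) - w) = (1 + w ^ 2) / ((t : ℂ) - w) + w := by
    field_simp [hne t]; ring
  rw [e]
  refine (norm_add_le _ _).trans ?_
  gcongr
  rw [norm_div]
  apply div_le_div₀ (by positivity) _ hw (hlow t)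
  refine (norm_add_le _ _).trans ?_
  simp

lemma aux_ball (α A B : ℝ) (ν : Measure ℝ) [IsFiniteMeasure ν]
    (hHN : ∀ w : ℂ, 0 < w.im →
      0 ≤ ((w - (α : ℂ)) *
          ((A : ℂ) + (B : ℂ) * w + ∫ t : ℝ, (1 + (t : ℂ) * w) / ((t : ℂ) - w) ∂ν)).im)
    (x y R η : ℝ) (hy : 0 < y) (hy1 : y ≤ η) (hη : 0 < η) (hη1 : η ≤ 1)
    (hd : 2 * η ≤ α - x) (hR : |x| ≤ R) :
    ν.real (Set.Icc (x - y) (x + y)) ≤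
      (|A| + |B| * (2 * R + |α|) + ((2 + R ^ 2) / η + R + 1) * ν.real Set.univ) * (2 / η) * y ^ 2 := by
  have h := hHN ⟨x, y⟩ hy
  have hi := aux_integrable ν ⟨x, y⟩ hy
  rw [mul_add, ← integral_const_mul, Complex.add_im] at h
  have hi2 := hi.const_mul ((⟨x, y⟩ : ℂ) - (α : ℂ))
  have him : (∫ t : ℝ, ((⟨x, y⟩ : ℂ) - (α : ℂ)) * ((1 + (t : ℂ) * ⟨x, y⟩) / ((t : ℂ) - ⟨x, y⟩)) ∂ν).im
      = ∫ t : ℝ, y * ((1 + t ^ 2) * (t - α) / ((t - x) ^ 2 + y ^ 2) - t) ∂ν := by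
    have := Complex.imCLM.integral_comp_comm hi2
    simp only [Complex.imCLM_apply] at this
    rw [← this]
    exact integral_congr_ae (ae_of_all _ fun t => aux_kernel α x y t hy)
  have hik : Integrable (fun t : ℝ => (1 + t ^ 2) * (t - α) / ((t - x) ^ 2 + y ^ 2) - t) ν := by
    have h1 := (Complex.imCLM.integrable_comp hi2).const_mul y⁻¹
    refine h1.congr (ae_of_all _ fun t => ?_)
    simp only [Complex.imCLM_apply]
    rw [aux_kernel α x y t hy, inv_mul_cancel_left₀ hy.ne']
  rw [him, integral_const_mul] at h
  have e1 : (((⟨x, y⟩ : ℂ) - (α : ℂ)) * ((A : ℂ) + (B : ℂ) * ⟨x, y⟩)).im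
      = y * (A + B * (2 * x - α)) := by
    simp; ring
  rw [e1, ← mul_add] at h
  have h2 := nonneg_of_mul_nonneg_right h hy
  have hind : Integrable ((Set.Icc (x - y) (x + y)).indicator (fun _ => η / (2 * y ^ 2))) ν :=
    (integrable_const _).indicator measurableSet_Icc
  have h3 := integral_mono hik ((integrable_const ((2 + R ^ 2) / η + R + 1)).sub hind)
    (fun t => aux_bound α x y t R η hy hy1 hη hη1 hd hR)
  simp only [Pi.sub_apply] at h3
  rw [integral_sub (integrable_const _) hind, integral_indicator_const _ measurableSet_Icc,
    integral_const, smul_eq_mul, smul_eq_mul] at h3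
  have h4 : B * (2 * x - α) ≤ |B| * (2 * R + |α|) := by
    refine (le_abs_self _).trans ?_
    rw [abs_mul]
    gcongr
    refine (abs_sub _ _).trans ?_
    rw [abs_mul, abs_two]; gcongr
  have h5 := le_abs_self A
  have h6 : ν.real (Set.Icc (x - y) (x + y)) * (η / (2 * y ^ 2)) ≤
    |A| + |B| * (2 * R + |α|) + ((2 + R ^ 2) / η + R + 1) * ν.real Set.univ := by linarith
  have h7 := mul_le_mul_of_nonneg_right h6 (by positivity : 0 ≤ (2 / η) * y ^ 2)
  calc _ = ν.real (Set.Icc (x - y) (x + y)) * (η / (2 * y ^ 2)) * ((2 / η) * y ^ 2) := by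
        field_simp
    _ ≤ _ := h7
    _ = _ := by ring

lemma aux_cover (ν : Measure ℝ) [IsFiniteMeasure ν] (a C η : ℝ) (hη : 0 < η)
    (h : ∀ x y, x ∈ Set.Icc a (a + η) → 0 < y → y ≤ η →
      ν.real (Set.Icc (x - y) (x + y)) ≤ C * y ^ 2) : ν (Set.Icc a (a + η)) = 0 := by
  have key : ∀ n : ℕ, ν.real (Set.Icc a (a + η)) ≤ C * η ^ 2 * (1 / ((n : ℝ) + 1))
      + C * η ^ 2 * (1 / ((n : ℝ) + 1)) * (1 / ((n : ℝ) + 1)) := by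
    intro n
    have hn : (0 : ℝ) < (n : ℝ) + 1 := by positivity
    set y := η / ((n : ℝ) + 1) with hy
    have hy0 : 0 < y := by positivity
    have hyn : y * ((n : ℝ) + 1) = η := by rw [hy]; field_simp
    have hy1 : y ≤ η := by nlinarith [(Nat.cast_nonneg n : (0 : ℝ) ≤ n)]
    have hsub : Set.Icc a (a + η) ⊆
        ⋃ k ∈ Finset.range (n + 2), Set.Icc (a + k * y - y) (a + k * y + y) := by
      intro t ht
      have h0 : 0 ≤ (t - a) / y := div_nonneg (by linarith [ht.1]) hy0.le
      have f1 := Nat.floor_le h0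
      have f2 := Nat.lt_floor_add_one ((t - a) / y)
      rw [le_div_iff₀ hy0] at f1
      rw [div_lt_iff₀ hy0] at f2
      simp only [Set.mem_iUnion, Finset.mem_range]
      refine ⟨⌊(t - a) / y⌋₊, ?_, by linarith, by linarith⟩
      have : (⌊(t - a) / y⌋₊ : ℝ) < ((n + 2 : ℕ) : ℝ) := by
        push_cast
        by_contra hc
        push Not at hc
        nlinarith [ht.2, mul_le_mul_of_nonneg_right hc hy0.le]
      exact_mod_cast this
    calc ν.real (Set.Icc a (a + η)) ≤ _ := measureReal_mono hsub (measure_ne_top _ _)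
      _ ≤ ∑ k ∈ Finset.range (n + 2), ν.real (Set.Icc (a + k * y - y) (a + k * y + y)) :=
        measureReal_biUnion_finset_le _ _
      _ ≤ ∑ k ∈ Finset.range (n + 2), C * y ^ 2 := by
        apply Finset.sum_le_sum
        intro k hk
        have hk' : (k : ℝ) ≤ (n : ℝ) + 1 := by
          exact_mod_cast Nat.lt_succ_iff.mp (Finset.mem_range.mp hk)
        refine h _ _ ⟨?_, ?_⟩ hy0 hy1
        · have : 0 ≤ (k : ℝ) * y := by positivity
          linarith
        · nlinarith
      _ = _ := by
        rw [Finset.sum_const, Finset.card_range, nsmul_eq_mul, hy]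
        push_cast
        field_simp
        ring
  have lim : Filter.Tendsto (fun n : ℕ => C * η ^ 2 * (1 / ((n : ℝ) + 1))
      + C * η ^ 2 * (1 / ((n : ℝ) + 1)) * (1 / ((n : ℝ) + 1))) Filter.atTop (nhds 0) := by
    have l := tendsto_one_div_add_atTop_nhds_zero_nat (𝕜 := ℝ)
    have := (l.const_mul (C * η ^ 2)).add ((l.const_mul (C * η ^ 2)).mul l)
    simpa using this
  have h0 : ν.real (Set.Icc a (a + η)) ≤ 0 := ge_of_tendsto' lim key
  exact (measureReal_eq_zero_iff).mp (le_antisymm h0 measureReal_nonneg)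

/-- Lemma (ML2217): if `F(w) = A + B·w + ∫ (1+tw)/(t-w) ν(dt)` is a scalar
Herglotz–Nevanlinna function such that `F^#(w) = (w-α)·F(w)` also has nonnegative imaginary
part on the upper half-plane, then the Nevanlinna measure `ν` and the spectral measure
`μ(E) = ∫_E (1+t²) ν(dt)` both vanish on `(-∞, α)`. -/
theorem nevanlinna_and_spectral_measure_vanish_left_of_alpha
    (α A B : ℝ) (hB : 0 ≤ B) (ν : Measure ℝ) [IsFiniteMeasure ν]
    (hHN : ∀ w : ℂ, 0 < w.im →
      0 ≤ ((w - (α : ℂ)) *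
          ((A : ℂ) + (B : ℂ) * w + ∫ t : ℝ, (1 + (t : ℂ) * w) / ((t : ℂ) - w) ∂ν)).im) :
    ν (Set.Iio α) = 0 ∧
      (ν.withDensity fun t => ENNReal.ofReal (1 + t ^ 2)) (Set.Iio α) = 0 := by
  have hν : ν (Set.Iio α) = 0 := by
    refine measure_null_of_locally_null _ fun x hx => ?_
    have hx' : x < α := hx
    set η := min 1 ((α - x) / 3) with hη
    have hη0 : 0 < η := lt_min one_pos (by linarith)
    have hη1 : η ≤ 1 := min_le_left _ _
    have hη2 : η ≤ (α - x) / 3 := min_le_right _ _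
    refine ⟨Set.Icc (x - η / 2) (x - η / 2 + η), mem_nhdsWithin_of_mem_nhds
      (Icc_mem_nhds (by linarith) (by linarith)), ?_⟩
    refine aux_cover ν _ _ η hη0 fun z y hz hy hy1 =>
      aux_ball α A B ν hHN z y (|x| + 1) η hy hy1 hη0 hη1 ?_ ?_
    · linarith [hz.2]
    · have h1 := le_abs_self x
      have h2 := neg_abs_le x
      rw [abs_le]
      constructor <;> linarith [hz.1, hz.2]
  exact ⟨hν, withDensity_absolutelyContinuous _ _ hν⟩
end

section
/- Let q ≥ 1, n ∈ ℕ₀, and let s_0, …, s_{2n} be Hermitian complex q×q matrices; write T := T_{q,n} and v := v_{q,n}. Then for all w, z ∈ ℂ: H_n·T*·R_{T*}(z) − (R_{T*}(w))*·T·H_n + (R_{T*}(w))*·(v·u_n* − u_n·v*)·R_{T*}(z) = (z − conj(w))·(R_{T*}(w))*·T·H_n·T*·R_{T*}(z). If moreover α ∈ ℝ and a Hermitian s_{2n+1} ∈ ℂ^{q×q} is given, then for all w, z ∈ ℂ: H_{α▷n}·T*·R_{T*}(z) − (R_{T*}(w))*·T·H_{α▷n} + (R_{T*}(w))*·( v·(−α·u_n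 − y_{0,n})* − (−α·u_n − y_{0,n})·v* )·R_{T*}(z) = (z − conj(w))·(R_{T*}(w))*·T·H_{α▷n}·T*·R_{T*}(z). -/
open Matrix ComplexConjugate

noncomputable section

/-- `R_{T*}(z) = (I - z·T_{q,n}*)⁻¹`. -/
def RTs (q n : ℕ) (z : ℂ) : Matrix (Fin (n + 1) × Fin q) (Fin (n + 1) × Fin q) ℂ :=
  (1 - z • (bshift q n)ᴴ)⁻¹

end

theorem bshift_pow_zero (q n k : ℕ) : ∀ i j : Fin (n + 1) × Fin q, i.1.val < k →
    ((bshift q n) ^ k) i j = 0 := by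
  induction k with
  | zero => intro i j h; omega
  | succ k ih =>
    intro i j h
    rw [pow_succ', Matrix.mul_apply]
    refine Finset.sum_eq_zero fun l _ => ?_
    by_cases hl : i.1.val = l.1.val + 1 ∧ i.2 = l.2
    · rw [ih l j (by omega), mul_zero]
    · simp [bshift, hl]

theorem bshift_unit (q n : ℕ) (z : ℂ) : IsUnit (1 - z • (bshift q n)ᴴ) := by
  have h : (bshift q n) ^ (n + 1) = 0 := by
    ext i j
    exact bshift_pow_zero q n (n + 1) i j i.1.isLt
  apply IsNilpotent.isUnit_one_sub
  refine ⟨n + 1, ?_⟩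
  rw [smul_pow, ← Matrix.conjTranspose_pow, h]
  simp

theorem bshift_mul_apply (q n : ℕ) (H : Matrix (Fin (n + 1) × Fin q) (Fin (n + 1) × Fin q) ℂ)
    (i j : Fin (n + 1) × Fin q) : (bshift q n * H) i j =
      if i.1.val = 0 then 0 else H (⟨i.1.val - 1, by omega⟩, i.2) j := by
  rw [Matrix.mul_apply]
  split_ifs with h
  · refine Finset.sum_eq_zero fun l _ => ?_
    have : ¬ (i.1.val = l.1.val + 1 ∧ i.2 = l.2) := by omega
    simp [bshift, this]
  · rw [Finset.sum_eq_single (⟨i.1.val - 1, by omega⟩, i.2)]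
    · have : i.1.val = i.1.val - 1 + 1 := by omega
      simp [bshift, ← this]
    · intro l _ hl
      have : ¬ (i.1.val = l.1.val + 1 ∧ i.2 = l.2) := by
        rintro ⟨h1, h2⟩
        apply hl
        ext
        · simp [h1]
        · simp [h2]
      simp [bshift, this]
    · simp

theorem mul_bshift_apply (q n : ℕ) (H : Matrix (Fin (n + 1) × Fin q) (Fin (n + 1) × Fin q) ℂ)
    (i j : Fin (n + 1) × Fin q) : (H * (bshift q n)ᴴ) i j =
      if j.1.val = 0 then 0 else H i (⟨j.1.val - 1, by omega⟩, j.2) := by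
  have h : H * (bshift q n)ᴴ = (bshift q n * Hᴴ)ᴴ := by simp
  rw [h, Matrix.conjTranspose_apply, bshift_mul_apply]
  split_ifs <;> simp

theorem vq_mul_apply (q n : ℕ) (u : Matrix (Fin (n + 1) × Fin q) (Fin q) ℂ)
    (i j : Fin (n + 1) × Fin q) : (vq q n * uᴴ) i j =
      if i.1.val = 0 then star (u j i.2) else 0 := by
  rw [Matrix.mul_apply]
  by_cases h : i.1.val = 0 <;> simp [vq, h, -Fin.val_eq_zero_iff]

theorem mul_vq_apply (q n : ℕ) (u : Matrix (Fin (n + 1) × Fin q) (Fin q) ℂ)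
    (i j : Fin (n + 1) × Fin q) : (u * (vq q n)ᴴ) i j =
      if j.1.val = 0 then u i j.2 else 0 := by
  have h : u * (vq q n)ᴴ = (vq q n * uᴴ)ᴴ := by simp
  rw [h, Matrix.conjTranspose_apply, vq_mul_apply]
  split_ifs <;> simp

theorem hank_core (q n : ℕ) (t : ℕ → Matrix (Fin q) (Fin q) ℂ)
    (u : Matrix (Fin (n + 1) × Fin q) (Fin q) ℂ)
    (ht : ∀ j < n, (t j)ᴴ = t j)
    (hu : ∀ (i : Fin (n + 1) × Fin q) b, i.1.val ≠ 0 → u i b = - t (i.1.val - 1) i.2 b)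
    (hu0 : ∀ (i j : Fin (n + 1) × Fin q), i.1.val = 0 → j.1.val = 0 →
      star (u j i.2) = u i j.2) :
    vq q n * uᴴ - u * (vq q n)ᴴ = bshift q n * hank q n t - hank q n t * (bshift q n)ᴴ := by
  ext i j
  rw [Matrix.sub_apply, Matrix.sub_apply, vq_mul_apply, mul_vq_apply, bshift_mul_apply,
    mul_bshift_apply]
  by_cases hi : i.1.val = 0 <;> by_cases hj : j.1.val = 0
  · simp [hi, hj, hu0 i j hi hj]
  · have := congrFun (congrFun (ht (j.1.val - 1) (by omega)) i.2) j.2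
    rw [Matrix.conjTranspose_apply] at this
    simp only [hi, hj, if_true, if_false, hu j _ hj, star_neg, this]
    simp [hank, hi]
  · simp [hi, hj, hu i _ hi, hank]
  · have : i.1.val - 1 + j.1.val = i.1.val + (j.1.val - 1) := by omega
    simp [hi, hj, hank, this]

theorem lyap_gen (q n : ℕ) (H M : Matrix (Fin (n + 1) × Fin q) (Fin (n + 1) × Fin q) ℂ)
    (hM : M = bshift q n * H - H * (bshift q n)ᴴ) (w z : ℂ) :
    H * (bshift q n)ᴴ * RTs q n z - (RTs q n w)ᴴ * bshift q n * H +
      (RTs q n w)ᴴ * M * RTs q n z =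
      (z - conj w) • ((RTs q n w)ᴴ * bshift q n * H * (bshift q n)ᴴ * RTs q n z) := by
  have h1 : (1 - z • (bshift q n)ᴴ) * RTs q n z = 1 :=
    Matrix.mul_nonsing_inv _ ((Matrix.isUnit_iff_isUnit_det _).1 (bshift_unit q n z))
  have h2 : (RTs q n w)ᴴ * (1 - conj w • bshift q n) = 1 := by
    have h : (1 - w • (bshift q n)ᴴ) * RTs q n w = 1 :=
      Matrix.mul_nonsing_inv _ ((Matrix.isUnit_iff_isUnit_det _).1 (bshift_unit q n w))
    simpa using congrArg Matrix.conjTranspose h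
  generalize (RTs q n w)ᴴ = A at *
  generalize RTs q n z = R at *
  generalize (bshift q n)ᴴ = S at *
  generalize bshift q n = T at *
  have e : H * S * R - A * T * H =
      A * (1 - conj w • T) * (H * S * R) - A * T * H * ((1 - z • S) * R) := by
    rw [h1, h2, one_mul, mul_one]
  rw [e, hM]
  simp only [mul_sub, sub_mul, mul_one, one_mul, smul_mul_assoc, mul_smul_comm, sub_smul,
    mul_assoc]
  abel

/-- Lemma 6.2 (D1451): Ljapunov-type identities for block Hankel matrices. -/
theorem lyapunov_identities_for_block_hankel_matrices
    (q : ℕ) (hq : 1 ≤ q) (n : ℕ) (α : ℝ)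
    (s : ℕ → Matrix (Fin q) (Fin q) ℂ) (hs : ∀ j ≤ 2 * n, (s j)ᴴ = s j) :
    (∀ w z : ℂ,
        hank q n s * (bshift q n)ᴴ * RTs q n z - (RTs q n w)ᴴ * bshift q n * hank q n s +
            (RTs q n w)ᴴ * (vq q n * (uq q n s)ᴴ - uq q n s * (vq q n)ᴴ) * RTs q n z =
          (z - conj w) •
            ((RTs q n w)ᴴ * bshift q n * hank q n s * (bshift q n)ᴴ * RTs q n z)) ∧
    ((s (2 * n + 1))ᴴ = s (2 * n + 1) →
      ∀ w z : ℂ,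
        hank q n (sShift α s) * (bshift q n)ᴴ * RTs q n z -
              (RTs q n w)ᴴ * bshift q n * hank q n (sShift α s) +
            (RTs q n w)ᴴ *
                (vq q n * ((-(α : ℂ)) • uq q n s - yq q n s)ᴴ -
                  ((-(α : ℂ)) • uq q n s - yq q n s) * (vq q n)ᴴ) * RTs q n z =
          (z - conj w) •
            ((RTs q n w)ᴴ * bshift q n * hank q n (sShift α s) * (bshift q n)ᴴ *
              RTs q n z)) := by
  refine ⟨fun w z => lyap_gen q n _ _ (hank_core q n s _ (fun j hj => hs j (by omega)) ?_ ?_) w z,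
    fun _ w z => lyap_gen q n _ _ (hank_core q n (sShift α s) _ (fun j hj => ?_) ?_ ?_) w z⟩
  · intro i b hi
    simp [uq, hi, -Fin.val_eq_zero_iff]
  · intro i j hi hj
    simp [uq, hi, hj, -Fin.val_eq_zero_iff]
  · simp [sShift, hs j (by omega), hs (j + 1) (by omega)]
  · intro i b hi
    have : i.1.val - 1 + 1 = i.1.val := by omega
    simp only [sShift, this]
    simp [uq, yq, hi, -Fin.val_eq_zero_iff]
    try ring
  · intro i j hi hj
    have := congrFun (congrFun (hs 0 (by omega)) i.2) j.2
    rw [Matrix.conjTranspose_apply] at this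
    simpa [uq, yq, hi, hj, -Fin.val_eq_zero_iff] using this
end

section
/- Let q ≥ 1, α ∈ ℝ, κ ∈ ℕ₀, let (s_j)_{j=0}^{κ} be Hermitian complex q×q matrices, and let f : ℂ∖[α,∞) → ℂ^{q×q} be a matrix-valued function. Then for every k ∈ {0, …, κ} there exist functions Γ_k : ℂ∖ℝ → ℂ^{(m_k+2)q × (2m_k+2)q} and Δ_k : ℂ∖ℝ → ℂ^{(2m_k+2)q × (m_k+2)q} such that for every z ∈ ℂ∖ℝ: P_k^{[f]}(z) = Γ_k(z) · Q_k^{[f]}(z) · Γ_k(z)* and Q_k^{[f]}(z) = Δ_k(z) · P_k^{[f]}(z) · Δ_k(z)*. -/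
open Matrix ComplexConjugate

noncomputable section

/-- The auxiliary matrix `F_{2n}(z)`. -/
def Feven (q n : ℕ) (s : ℕ → Matrix (Fin q) (Fin q) ℂ)
    (f : ℂ → Matrix (Fin q) (Fin q) ℂ) (z : ℂ) :
    Matrix (Fin (n + 1) × Fin q) (Fin (n + 1) × Fin q) ℂ :=
  hank q n s * (bshift q n)ᴴ * RTs q n z +
    RT q n z * (vq q n * f z - uq q n s) * (vq q n)ᴴ * RTs q n z

/-- The auxiliary matrix `F_{2n+1}(z)`. -/
def Fodd (q n : ℕ) (α : ℝ) (s : ℕ → Matrix (Fin q) (Fin q) ℂ)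
    (f : ℂ → Matrix (Fin q) (Fin q) ℂ) (z : ℂ) :
    Matrix (Fin (n + 1) × Fin q) (Fin (n + 1) × Fin q) ℂ :=
  hank q n (sShift α s) * (bshift q n)ᴴ * RTs q n z +
    RT q n z * (vq q n * ((z - (α : ℂ)) • f z) - ((-(α : ℂ)) • uq q n s - yq q n s)) *
      (vq q n)ᴴ * RTs q n z

/-- The auxiliary matrix `Q_{2n}^{[f]}(z)`. -/
def Qeven (q n : ℕ) (s : ℕ → Matrix (Fin q) (Fin q) ℂ)
    (f : ℂ → Matrix (Fin q) (Fin q) ℂ) (z : ℂ) :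
    Matrix ((Fin (n + 1) × Fin q) ⊕ (Fin (n + 1) × Fin q))
      ((Fin (n + 1) × Fin q) ⊕ (Fin (n + 1) × Fin q)) ℂ :=
  Matrix.fromBlocks (hank q n s) (Feven q n s f z) (Feven q n s f z)ᴴ
    ((z - conj z)⁻¹ • (Feven q n s f z - (Feven q n s f z)ᴴ))

/-- The auxiliary matrix `Q_{2n+1}^{[f]}(z)`. -/
def Qodd (q n : ℕ) (α : ℝ) (s : ℕ → Matrix (Fin q) (Fin q) ℂ)
    (f : ℂ → Matrix (Fin q) (Fin q) ℂ) (z : ℂ) :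
    Matrix ((Fin (n + 1) × Fin q) ⊕ (Fin (n + 1) × Fin q))
      ((Fin (n + 1) × Fin q) ⊕ (Fin (n + 1) × Fin q)) ℂ :=
  Matrix.fromBlocks (hank q n (sShift α s)) (Fodd q n α s f z) (Fodd q n α s f z)ᴴ
    ((z - conj z)⁻¹ • (Fodd q n α s f z - (Fodd q n α s f z)ᴴ))

end

theorem aux_cong {m p : Type*} [Fintype m] [Fintype p] [DecidableEq m] [DecidableEq p]
    (H T R S : Matrix m m ℂ) (v u B : Matrix m p ℂ) (g : Matrix p p ℂ) (z : ℂ) (F : Matrix m m ℂ)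
    (hz : z.im ≠ 0) (hH : Hᴴ = H)
    (hL : H * Tᴴ - T * H = u * vᴴ - v * uᴴ)
    (hvv : vᴴ * v = 1) (hTv : Tᴴ * v = 0) (hu : (vᴴ * u)ᴴ = vᴴ * u)
    (hR : (1 - z • T) * R = 1)
    (hS : S * (1 - z • Tᴴ) = 1)
    (hB : B = R * (v * g - u)) (hF : F = H * Tᴴ * S + B * vᴴ * S) :
    fromBlocks H B Bᴴ ((z - conj z)⁻¹ • (g - gᴴ)) =
      fromBlocks (1 : Matrix m m ℂ) 0 0 vᴴ * fromBlocks H F Fᴴ ((z - conj z)⁻¹ • (F - Fᴴ)) *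
        (fromBlocks (1 : Matrix m m ℂ) 0 0 vᴴ)ᴴ ∧
    fromBlocks H F Fᴴ ((z - conj z)⁻¹ • (F - Fᴴ)) =
      fromBlocks (1 : Matrix m m ℂ) 0 (Tᴴ * S)ᴴ (vᴴ * S)ᴴ *
        fromBlocks H B Bᴴ ((z - conj z)⁻¹ • (g - gᴴ)) *
        (fromBlocks (1 : Matrix m m ℂ) 0 (Tᴴ * S)ᴴ (vᴴ * S)ᴴ)ᴴ := by
  have hw : z - conj z ≠ 0 := by
    intro h
    apply hz
    have := congrArg Complex.im h
    simp at this
    linarith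
  have hB1 : B - z • (T * B) = v * g - u := by
    have : (1 - z • T) * B = v * g - u := by
      rw [hB, ← Matrix.mul_assoc, hR, Matrix.one_mul]
    rw [← this, Matrix.sub_mul, Matrix.one_mul, Matrix.smul_mul]
  have hvT : vᴴ * T = 0 := by
    have := congrArg conjTranspose hTv
    simpa using this
  have hvB : vᴴ * B = g - vᴴ * u := by
    have := congrArg (fun X => vᴴ * X) hB1
    simp only [Matrix.mul_sub, Matrix.mul_smul, ← Matrix.mul_assoc, hvT, hvv] at this
    simpa using this
  have hSv : S * v = v := by
    have h1 : (1 - z • Tᴴ) * v = v := by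
      rw [Matrix.sub_mul, Matrix.smul_mul, hTv]; simp
    calc S * v = S * ((1 - z • Tᴴ) * v) := by rw [h1]
      _ = v := by rw [← Matrix.mul_assoc, hS, Matrix.one_mul]
  have hFv : F * v = B := by
    rw [hF, Matrix.add_mul, Matrix.mul_assoc, hSv, Matrix.mul_assoc _ S, hSv, Matrix.mul_assoc,
      hTv, Matrix.mul_assoc, hvv]; simp
  have hvFv : vᴴ * (F - Fᴴ) * v = g - gᴴ := by
    have h1 : vᴴ * F * v = g - vᴴ * u := by rw [Matrix.mul_assoc, hFv, hvB]
    have h2 : vᴴ * Fᴴ * v = gᴴ - vᴴ * u := by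
      have := congrArg conjTranspose h1
      rw [conjTranspose_sub, hu] at this
      rw [← this]; simp [Matrix.mul_assoc]
    rw [Matrix.mul_sub, Matrix.sub_mul, h1, h2]; abel
  have hS' : Sᴴ - conj z • (Sᴴ * 0) = Sᴴ := by simp
  have hSH : (1 - conj z • T) * Sᴴ = 1 := by
    have := congrArg conjTranspose hS
    simpa using this
  have hSHc : Sᴴ * (1 - conj z • T) = 1 := mul_eq_one_comm.mp hSH
  have hSc : (1 - z • Tᴴ) * S = 1 := mul_eq_one_comm.mp hS
  have hB2 : Bᴴ - conj z • (Bᴴ * Tᴴ) = gᴴ * vᴴ - uᴴ := by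
    have := congrArg conjTranspose hB1
    simpa using this
  have hF1 : F = Sᴴ * ((1 - conj z • T) * (H * Tᴴ + B * vᴴ)) * S := by
    rw [← Matrix.mul_assoc Sᴴ, hSHc, hF, Matrix.one_mul, Matrix.add_mul]
  have hF2 : Fᴴ = Sᴴ * ((T * H + v * Bᴴ) * (1 - z • Tᴴ)) * S := by
    rw [Matrix.mul_assoc, Matrix.mul_assoc, hSc, hF, Matrix.mul_one, Matrix.mul_add]
    simp [hH, Matrix.mul_assoc]
  have hmid : (1 - conj z • T) * (H * Tᴴ + B * vᴴ) - (T * H + v * Bᴴ) * (1 - z • Tᴴ) =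
      (z - conj z) • (T * H * Tᴴ + v * Bᴴ * Tᴴ + T * B * vᴴ) + v * (g - gᴴ) * vᴴ := by
    have e1 := congrArg (fun X => X * vᴴ) hB1
    have e2 := congrArg (fun X => v * X) hB2
    simp only [Matrix.sub_mul, Matrix.mul_sub, Matrix.smul_mul, Matrix.mul_smul,
      ← Matrix.mul_assoc] at e1 e2
    simp only [Matrix.sub_mul, Matrix.mul_sub, Matrix.add_mul, Matrix.mul_add, Matrix.smul_mul,
      Matrix.mul_smul, Matrix.one_mul, Matrix.mul_one, ← Matrix.mul_assoc, sub_smul, smul_add]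
    rw [← sub_eq_zero] at e1 e2 hL ⊢
    have := congrArg₂ (· + ·) (congrArg₂ (· - ·) e1 e2) hL
    simp only [sub_zero, add_zero] at this
    rw [← this]
    abel
  have hD : F - Fᴴ = (z - conj z) • (Sᴴ * T * H * Tᴴ * S + Sᴴ * v * Bᴴ * Tᴴ * S
      + Sᴴ * T * B * vᴴ * S) + Sᴴ * v * (g - gᴴ) * vᴴ * S := by
    conv_lhs => rw [hF2]
    nth_rewrite 1 [hF1]
    rw [← Matrix.sub_mul, ← Matrix.mul_sub, hmid]
    simp only [Matrix.add_mul, Matrix.mul_add, Matrix.smul_mul, Matrix.mul_smul, Matrix.mul_assoc]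
  constructor
  · have hFv' : vᴴ * Fᴴ = Bᴴ := by rw [← hFv]; simp
    rw [fromBlocks_conjTranspose, fromBlocks_multiply, fromBlocks_multiply]
    simp [hFv, hFv']
    rw [hvFv]
  · rw [fromBlocks_conjTranspose, fromBlocks_multiply, fromBlocks_multiply, fromBlocks_inj]
    refine ⟨by simp, ?_, ?_, ?_⟩
    · simp [hF, Matrix.mul_assoc]
    · simp [hF, hH, Matrix.mul_assoc]
    · rw [hD, smul_add, smul_smul, inv_mul_cancel₀ hw]
      simp [Matrix.add_mul, Matrix.mul_add, Matrix.mul_assoc]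
      abel

theorem bshift_pow (q n k : ℕ) : ∀ i j, (bshift q n ^ k) i j ≠ 0 → i.1.val = j.1.val + k := by
  induction k with
  | zero =>
    intro i j h
    rw [pow_zero, Matrix.one_apply] at h
    simp at h
    simp [h]
  | succ k ih =>
    intro i j h
    rw [pow_succ, Matrix.mul_apply] at h
    obtain ⟨l, -, hl⟩ := Finset.exists_ne_zero_of_sum_ne_zero h
    have h1 := ih i l (left_ne_zero_of_mul hl)
    have h2 := right_ne_zero_of_mul hl
    simp [bshift] at h2
    omega

theorem bshift_nil (q n : ℕ) : bshift q n ^ (n + 1) = 0 := by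
  ext i j
  by_contra h
  have := bshift_pow q n (n + 1) i j h
  have := i.1.2
  omega

theorem RT_spec (q n : ℕ) (z : ℂ) : (1 - z • bshift q n) * RT q n z = 1 := by
  have h : IsUnit (1 - z • bshift q n) := by
    apply IsNilpotent.isUnit_one_sub
    exact ⟨n + 1, by rw [smul_pow, bshift_nil, smul_zero]⟩
  exact Matrix.mul_nonsing_inv _ ((Matrix.isUnit_iff_isUnit_det _).1 h)

theorem RTs_spec (q n : ℕ) (z : ℂ) : RTs q n z * (1 - z • (bshift q n)ᴴ) = 1 := by
  have h : IsUnit (1 - z • (bshift q n)ᴴ) := by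
    apply IsNilpotent.isUnit_one_sub
    exact ⟨n + 1, by rw [smul_pow, ← conjTranspose_pow, bshift_nil]; simp⟩
  exact Matrix.nonsing_inv_mul _ ((Matrix.isUnit_iff_isUnit_det _).1 h)

theorem vq_vq (q n : ℕ) : (vq q n)ᴴ * vq q n = 1 := by
  ext i j
  rw [Matrix.mul_apply, Finset.sum_eq_single ((0 : Fin (n+1)), i)]
  · simp [vq, Matrix.one_apply]
  · rintro ⟨a, b⟩ - h
    simp only [vq, conjTranspose_apply, of_apply]
    rw [if_neg]
    · simp
    · rintro ⟨h1, h2⟩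
      apply h
      ext <;> simp_all
  · simp

theorem bs_vq (q n : ℕ) : (bshift q n)ᴴ * vq q n = 0 := by
  ext i j
  rw [Matrix.mul_apply]
  apply Finset.sum_eq_zero
  rintro ⟨a, b⟩ -
  simp only [vq, bshift, conjTranspose_apply, of_apply]
  split_ifs <;> simp
  omega

theorem vq_mul (q n : ℕ) (X : Matrix (Fin (n + 1) × Fin q) (Fin q) ℂ) (i j) :
    ((vq q n)ᴴ * X) i j = X (0, i) j := by
  rw [Matrix.mul_apply, Finset.sum_eq_single ((0 : Fin (n+1)), i)]
  · simp [vq]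
  · rintro ⟨a, b⟩ - h
    simp only [vq, conjTranspose_apply, of_apply]
    rw [if_neg]
    · simp
    · rintro ⟨h1, h2⟩
      apply h
      ext <;> simp_all
  · simp

theorem mul_vqH (q n : ℕ) (X : Matrix (Fin (n + 1) × Fin q) (Fin q) ℂ) (i j) :
    (X * (vq q n)ᴴ) i j = if j.1.val = 0 then X i j.2 else 0 := by
  rw [Matrix.mul_apply]
  simp only [vq, conjTranspose_apply, of_apply]
  split_ifs with h <;> simp [h]

theorem mul_bsH (q n : ℕ) (s : ℕ → Matrix (Fin q) (Fin q) ℂ) (i j) :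
    (hank q n s * (bshift q n)ᴴ) i j =
      if j.1.val = 0 then 0 else s (i.1.val + j.1.val - 1) i.2 j.2 := by
  rw [Matrix.mul_apply]
  split_ifs with h
  · apply Finset.sum_eq_zero
    rintro ⟨a, b⟩ -
    simp [bshift, h]
  · rw [Finset.sum_eq_single ((⟨j.1.val - 1, by omega⟩ : Fin (n+1)), j.2)]
    · have : j.1.val = j.1.val - 1 + 1 := by omega
      simp [bshift, hank, ← this]
      rw [Nat.add_sub_assoc (by omega)]
    · rintro ⟨a, b⟩ - hne
      simp only [bshift, conjTranspose_apply, of_apply]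
      rw [if_neg]
      · simp
      · rintro ⟨h1, h2⟩
        apply hne
        ext <;> simp_all
    · simp

theorem hank_herm (q n : ℕ) (s : ℕ → Matrix (Fin q) (Fin q) ℂ)
    (hs : ∀ j ≤ 2 * n, (s j)ᴴ = s j) : (hank q n s)ᴴ = hank q n s := by
  ext i j
  have := congrFun (congrFun (hs (i.1.val + j.1.val) (by omega)) i.2) j.2
  simp only [hank, conjTranspose_apply, of_apply] at *
  rw [add_comm, this]

theorem lyap (q n : ℕ) (s : ℕ → Matrix (Fin q) (Fin q) ℂ)
    (hs : ∀ j ≤ 2 * n, (s j)ᴴ = s j) (u : Matrix (Fin (n + 1) × Fin q) (Fin q) ℂ)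
    (hu0 : ∀ a b, star (u (0, a) b) = u (0, b) a)
    (hu : ∀ j b, j.1.val ≠ 0 → u j b = - s (j.1.val - 1) j.2 b) :
    hank q n s * (bshift q n)ᴴ - bshift q n * hank q n s = u * (vq q n)ᴴ - vq q n * uᴴ := by
  have e1 : bshift q n * hank q n s = (hank q n s * (bshift q n)ᴴ)ᴴ := by
    simp [hank_herm q n s hs]
  have e2 : vq q n * uᴴ = (u * (vq q n)ᴴ)ᴴ := by simp
  have hs' : ∀ k ≤ 2 * n, ∀ a b, star (s k a b) = s k b a := fun k hk a b => by
    have := congrFun (congrFun (hs k hk) b) a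
    simpa using this
  rw [e1, e2]
  ext ⟨i, a⟩ ⟨j, b⟩
  simp only [Matrix.sub_apply, conjTranspose_apply, mul_bsH, mul_vqH]
  by_cases hi : i.val = 0 <;> by_cases hj : j.val = 0
  · have hi' : i = 0 := Fin.ext hi
    have hj' : j = 0 := Fin.ext hj
    subst hi' hj'
    simp only [Fin.val_zero, if_true, star_zero, sub_zero]
    rw [hu0, sub_self]
  · rw [if_neg hj, if_pos hi, if_neg hj, if_pos hi, hu _ _ hj, star_neg, hs' _ (by simp only; omega)]
    simp [hi]
  · rw [if_pos hj, if_neg hi, if_pos hj, if_neg hi, hu _ _ hi, hs' _ (by omega)]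
    simp [hj]
  · rw [if_neg hj, if_neg hi, if_neg hj, if_neg hi, hs' _ (by omega), add_comm]
    simp


/-- Proposition (Mi,L3.3): the Potapov matrices `P_k^{[f]}` and the auxiliary matrices
`Q_k^{[f]}` are mutually congruent via suitable matrix functions `Γ_k` and `Δ_k`. -/
theorem potapov_and_auxiliary_matrices_mutually_congruent
    (q : ℕ) (hq : 1 ≤ q) (α : ℝ) (κ : ℕ)
    (s : ℕ → Matrix (Fin q) (Fin q) ℂ) (hs : ∀ j ≤ κ, (s j)ᴴ = s j)
    (f : ℂ → Matrix (Fin q) (Fin q) ℂ) :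
    (∀ n : ℕ, 2 * n ≤ κ →
      ∃ (Γ : ℂ → Matrix ((Fin (n + 1) × Fin q) ⊕ Fin q)
              ((Fin (n + 1) × Fin q) ⊕ (Fin (n + 1) × Fin q)) ℂ)
        (Δ : ℂ → Matrix ((Fin (n + 1) × Fin q) ⊕ (Fin (n + 1) × Fin q))
              ((Fin (n + 1) × Fin q) ⊕ Fin q) ℂ),
        ∀ z : ℂ, z.im ≠ 0 →
          Peven q n s f z = Γ z * Qeven q n s f z * (Γ z)ᴴ ∧
          Qeven q n s f z = Δ z * Peven q n s f z * (Δ z)ᴴ) ∧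
    (∀ n : ℕ, 2 * n + 1 ≤ κ →
      ∃ (Γ : ℂ → Matrix ((Fin (n + 1) × Fin q) ⊕ Fin q)
              ((Fin (n + 1) × Fin q) ⊕ (Fin (n + 1) × Fin q)) ℂ)
        (Δ : ℂ → Matrix ((Fin (n + 1) × Fin q) ⊕ (Fin (n + 1) × Fin q))
              ((Fin (n + 1) × Fin q) ⊕ Fin q) ℂ),
        ∀ z : ℂ, z.im ≠ 0 →
          Podd q n α s f z = Γ z * Qodd q n α s f z * (Γ z)ᴴ ∧
          Qodd q n α s f z = Δ z * Podd q n α s f z * (Δ z)ᴴ) := by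
  have star_u : ∀ (n : ℕ) (u : Matrix (Fin (n + 1) × Fin q) (Fin q) ℂ),
      (∀ a b, star (u (0, a) b) = u (0, b) a) → ((vq q n)ᴴ * u)ᴴ = (vq q n)ᴴ * u := by
    intro n u h
    ext i j
    rw [conjTranspose_apply, vq_mul, vq_mul, h]
  constructor
  · intro n hn
    have hs' : ∀ j ≤ 2 * n, (s j)ᴴ = s j := fun j hj => hs j (by omega)
    have h0 : ∀ a b, star (uq q n s (0, a) b) = uq q n s (0, b) a := by
      intro a b; simp [uq]
    have hL := lyap q n s hs' (uq q n s) h0 (by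
      intro j b hj; simp only [uq, of_apply, if_neg hj])
    refine ⟨fun _ => fromBlocks 1 0 0 (vq q n)ᴴ,
      fun z => fromBlocks 1 0 ((bshift q n)ᴴ * RTs q n z)ᴴ ((vq q n)ᴴ * RTs q n z)ᴴ, ?_⟩
    intro z hz
    exact aux_cong _ _ _ _ _ _ _ _ z _ hz (hank_herm q n s hs') hL (vq_vq q n) (bs_vq q n)
      (star_u n _ h0) (RT_spec q n z) (RTs_spec q n z) rfl rfl
  · intro n hn
    have hs' : ∀ j ≤ 2 * n, (sShift α s j)ᴴ = sShift α s j := fun j hj => by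
      simp [sShift, hs j (by omega), hs (j + 1) (by omega)]
    have h0 : ∀ a b, star (((-(α : ℂ)) • uq q n s - yq q n s) (0, a) b) =
        ((-(α : ℂ)) • uq q n s - yq q n s) (0, b) a := by
      intro a b
      have := congrFun (congrFun (hs 0 (by omega)) b) a
      simpa [uq, yq] using this
    have hL := lyap q n _ hs' ((-(α : ℂ)) • uq q n s - yq q n s) h0 (by
      intro j b hj
      have : j.1.val - 1 + 1 = j.1.val := by omega
      simp only [uq, yq, sShift, of_apply, if_neg hj, Matrix.sub_apply, Matrix.smul_apply,
        Matrix.add_apply, smul_eq_mul, this]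
      ring)
    refine ⟨fun _ => fromBlocks 1 0 0 (vq q n)ᴴ,
      fun z => fromBlocks 1 0 ((bshift q n)ᴴ * RTs q n z)ᴴ ((vq q n)ᴴ * RTs q n z)ᴴ, ?_⟩
    intro z hz
    exact aux_cong _ _ _ _ _ _ _ _ z _ hz (hank_herm q n _ hs') hL (vq_vq q n) (bs_vq q n)
      (star_u n _ h0) (RT_spec q n z) (RTs_spec q n z) rfl rfl
end

section
/- Let q ≥ 1, α ∈ ℝ, κ ∈ ℕ₀, let (s_j)_{j=0}^{κ} be Hermitian complex q×q matrices, and let f : ℂ∖[α,∞) → ℂ^{q×q}. (a) For each n ∈ ℕ₀ with 2n ≤ κ, the map Ψ_{2n}(z) := R_T(z)·(H_n·T* − u_n·v* − z·T·H_n·T*)·R_{T*}(z) is a matrix polynomial in z (in particular continuous on ℂ), Ψ_{2n}(x) is Hermitian for every x ∈ ℝ, and F_{2n}(z) = Ψ_{2n}(z) + E_{q,n}(z)·f(z)·E_{q,n}(conj(z))* for every z ∈ ℍ. (b) For each n ∈ ℕ₀ with 2n+1 ≤ κ, the map Ψ_{2n+1}(z) := R_T(z)·(H_{α▷n}·T*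 − (−α·u_n − y_{0,n})·v* − z·T·H_{α▷n}·T*)·R_{T*}(z) is a matrix polynomial, Ψ_{2n+1}(x) is Hermitian for every x ∈ ℝ, and F_{2n+1}(z) = Ψ_{2n+1}(z) + E_{q,n}(z)·((z−α)·f(z))·E_{q,n}(conj(z))* for every z ∈ ℍ. -/
open Matrix ComplexConjugate

noncomputable section

/-- `E_{q,n}(z) = col(z^j·I_q)_{j=0}^n`. -/
def Ecol (q n : ℕ) (z : ℂ) : Matrix (Fin (n + 1) × Fin q) (Fin q) ℂ :=
  Matrix.of fun j b => if j.2 = b then z ^ j.1.val else 0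

/-- `Ψ_{2n}(z) = R_T(z)·(H_n·T* - u_n·v* - z·T·H_n·T*)·R_{T*}(z)`. -/
def Psieven (q n : ℕ) (s : ℕ → Matrix (Fin q) (Fin q) ℂ) (z : ℂ) :
    Matrix (Fin (n + 1) × Fin q) (Fin (n + 1) × Fin q) ℂ :=
  RT q n z *
    (hank q n s * (bshift q n)ᴴ - uq q n s * (vq q n)ᴴ -
      z • (bshift q n * hank q n s * (bshift q n)ᴴ)) * RTs q n z

/-- `Ψ_{2n+1}(z) = R_T(z)·(H_{α▷n}·T* - (-α·u_n - y_{0,n})·v* - z·T·H_{α▷n}·T*)·R_{T*}(z)`. -/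
def Psiodd (q n : ℕ) (α : ℝ) (s : ℕ → Matrix (Fin q) (Fin q) ℂ) (z : ℂ) :
    Matrix (Fin (n + 1) × Fin q) (Fin (n + 1) × Fin q) ℂ :=
  RT q n z *
    (hank q n (sShift α s) * (bshift q n)ᴴ -
      ((-(α : ℂ)) • uq q n s - yq q n s) * (vq q n)ᴴ -
      z • (bshift q n * hank q n (sShift α s) * (bshift q n)ᴴ)) * RTs q n z

end

theorem bshift_pow_apply_s8 (q n k : ℕ) (i j : Fin (n + 1) × Fin q) :
    (bshift q n ^ k) i j = if i.1.val = j.1.val + k ∧ i.2 = j.2 then (1 : ℂ) else 0 := by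
  induction k generalizing i j with
  | zero =>
    simp only [pow_zero, Matrix.one_apply, add_zero, Prod.ext_iff, Fin.ext_iff]
  | succ k ih =>
    rw [pow_succ', Matrix.mul_apply]
    simp only [ih]
    simp only [bshift, Matrix.of_apply]
    by_cases h : i.1.val = j.1.val + (k + 1) ∧ i.2 = j.2
    · rw [if_pos h]
      rw [Finset.sum_eq_single ((⟨j.1.val + k, by have := i.1.isLt; omega⟩ : Fin (n + 1)), j.2)]
      · simp [h]
        omega
      · rintro ⟨b1, b2⟩ - hb
        simp only [← ite_and, mul_ite, mul_one, mul_zero]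
        rw [if_neg]
        rintro ⟨⟨h1, h2⟩, h3, h4⟩
        exact hb (Prod.ext (Fin.ext h1) h2)
      · simp
    · rw [if_neg h]
      apply Finset.sum_eq_zero
      rintro ⟨b1, b2⟩ -
      simp only [← ite_and, mul_ite, mul_one, mul_zero]
      rw [if_neg]
      rintro ⟨⟨h1, h2⟩, h3, h4⟩
      apply h
      exact ⟨by omega, by rw [h4, h2]⟩

theorem geom_right_inv {m : Type*} [Fintype m] [DecidableEq m] (A : Matrix m m ℂ) (N : ℕ)
    (hA : A ^ N = 0) (z : ℂ) :
    (1 - z • A) * (∑ k ∈ Finset.range N, z ^ k • A ^ k) = 1 := by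
  have := mul_neg_geom_sum (z • A) N
  simp only [smul_pow, hA, smul_zero, sub_zero] at this
  exact this

theorem RT_eq (q n : ℕ) (z : ℂ) :
    RT q n z = ∑ k ∈ Finset.range (n + 1), z ^ k • bshift q n ^ k :=
  Matrix.inv_eq_right_inv (geom_right_inv _ _ (bshift_nil q n) z)

theorem RTs_eq (q n : ℕ) (z : ℂ) :
    RTs q n z = ∑ k ∈ Finset.range (n + 1), z ^ k • (bshift q n)ᴴ ^ k := by
  refine Matrix.inv_eq_right_inv (geom_right_inv _ _ ?_ z)
  rw [← Matrix.conjTranspose_pow, bshift_nil, Matrix.conjTranspose_zero]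

theorem RT_mul (q n : ℕ) (z : ℂ) : RT q n z * (1 - z • bshift q n) = 1 := by
  rw [RT_eq]
  exact mul_eq_one_comm.mp (geom_right_inv _ _ (bshift_nil q n) z)

theorem RT_conj (q n : ℕ) (z : ℂ) : (RT q n (conj z))ᴴ = RTs q n z := by
  rw [RT, RTs, Matrix.conjTranspose_nonsing_inv]
  simp [Matrix.conjTranspose_smul]

theorem RT_vq (q n : ℕ) (z : ℂ) : RT q n z * vq q n = Ecol q n z := by
  have h0 : ∀ k ≤ n, ∀ i : Fin (n + 1) × Fin q, ∀ b, (bshift q n ^ k * vq q n) i b =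
      if i.1.val = k ∧ i.2 = b then (1 : ℂ) else 0 := by
    intro k hk i b
    rw [Matrix.mul_apply, Finset.sum_eq_single ((0 : Fin (n + 1)), b)]
    · simp [bshift_pow_apply_s8, vq]
    · rintro ⟨b1, b2⟩ - hb
      simp only [vq, Matrix.of_apply]
      rw [if_neg, mul_zero]
      rintro ⟨h1, h2⟩
      exact hb (Prod.ext (Fin.ext h1) h2)
    · simp
  ext i b
  rw [RT_eq, Matrix.sum_mul, Matrix.sum_apply, Finset.sum_eq_single i.1.val]
  · rw [Matrix.smul_mul, Matrix.smul_apply, h0 _ (by have := i.1.isLt; omega)]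
    simp [Ecol]
  · intro k hk hne
    rw [Matrix.smul_mul, Matrix.smul_apply, h0 _ (by have := Finset.mem_range.mp hk; omega),
      if_neg (fun h => hne h.1.symm), smul_zero]
  · intro h
    exact absurd (Finset.mem_range.mpr i.1.isLt) h

theorem vq_RTs (q n : ℕ) (z : ℂ) : (vq q n)ᴴ * RTs q n z = (Ecol q n (conj z))ᴴ := by
  rw [← RT_vq, Matrix.conjTranspose_mul, RT_conj]

theorem poly_exists (q n : ℕ) (A B : Matrix (Fin (n + 1) × Fin q) (Fin (n + 1) × Fin q) ℂ) :
    ∃ (N : ℕ) (C : ℕ → Matrix (Fin (n + 1) × Fin q) (Fin (n + 1) × Fin q) ℂ),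
      ∀ z : ℂ, RT q n z * (A - z • B) * RTs q n z = ∑ j ∈ Finset.range (N + 1), z ^ j • C j := by
  obtain ⟨P, hP⟩ : ∃ P : Matrix (Fin (n + 1) × Fin q) (Fin (n + 1) × Fin q) (Polynomial ℂ),
      ∀ z : ℂ, RT q n z * (A - z • B) * RTs q n z = P.map (Polynomial.evalRingHom z) := by
    have hgeo : ∀ D : ℕ → Matrix (Fin (n + 1) × Fin q) (Fin (n + 1) × Fin q) ℂ, ∀ z : ℂ,
        (∑ k ∈ Finset.range (n + 1), z ^ k • D k) =
        (∑ k ∈ Finset.range (n + 1), (Polynomial.X : Polynomial ℂ) ^ k •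
          (D k).map Polynomial.C).map (Polynomial.evalRingHom z) := by
      intro D z
      ext i j
      simp [Matrix.sum_apply, Polynomial.eval_finsetSum]
      exact Finset.sum_congr rfl fun _ _ => mul_comm _ _
    refine ⟨(∑ k ∈ Finset.range (n + 1), (Polynomial.X : Polynomial ℂ) ^ k •
          (bshift q n ^ k).map Polynomial.C) *
        (A.map Polynomial.C - (Polynomial.X : Polynomial ℂ) • B.map Polynomial.C) *
        (∑ k ∈ Finset.range (n + 1), (Polynomial.X : Polynomial ℂ) ^ k •
          ((bshift q n)ᴴ ^ k).map Polynomial.C), fun z => ?_⟩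
    rw [Matrix.map_mul, Matrix.map_mul, ← hgeo, ← hgeo, RT_eq, RTs_eq]
    congr 2
    ext i j
    simp
    exact mul_comm _ _
  refine ⟨Finset.univ.sup fun p : (Fin (n + 1) × Fin q) × (Fin (n + 1) × Fin q) =>
    (P p.1 p.2).natDegree, fun k => P.map fun r => r.coeff k, fun z => ?_⟩
  rw [hP]
  ext i j
  simp only [Matrix.map_apply, Polynomial.coe_evalRingHom, Matrix.sum_apply, Matrix.smul_apply,
    smul_eq_mul]
  rw [Polynomial.eval_eq_sum_range' (Nat.lt_succ_of_le
    (Finset.le_sup (f := fun p : (Fin (n + 1) × Fin q) × (Fin (n + 1) × Fin q) =>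
    (P p.1 p.2).natDegree) (Finset.mem_univ (i, j))))]
  exact Finset.sum_congr rfl fun _ _ => mul_comm _ _

theorem poly_cont (q n : ℕ) (A B : Matrix (Fin (n + 1) × Fin q) (Fin (n + 1) × Fin q) ℂ) :
    Continuous fun z : ℂ => RT q n z * (A - z • B) * RTs q n z := by
  obtain ⟨N, C, h⟩ := poly_exists q n A B
  simp only [h]
  fun_prop

theorem herm_gen (q n : ℕ) (A B : Matrix (Fin (n + 1) × Fin q) (Fin (n + 1) × Fin q) ℂ)
    (hA : Aᴴ = A) (hB : Bᴴ = B) (x : ℝ) :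
    (RT q n x * (A - (x : ℂ) • B) * RTs q n x)ᴴ = RT q n x * (A - (x : ℂ) • B) * RTs q n x := by
  have h1 : (RT q n x)ᴴ = RTs q n x := by
    have := RT_conj q n x
    rwa [Complex.conj_ofReal] at this
  have h2 : (RTs q n x)ᴴ = RT q n x := by rw [← h1, Matrix.conjTranspose_conjTranspose]
  simp only [Matrix.conjTranspose_mul, h1, h2, Matrix.conjTranspose_sub, Matrix.conjTranspose_smul,
    hA, hB, Matrix.mul_assoc]
  simp

theorem decomp_gen (q n : ℕ) (H : Matrix (Fin (n + 1) × Fin q) (Fin (n + 1) × Fin q) ℂ)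
    (u : Matrix (Fin (n + 1) × Fin q) (Fin q) ℂ) (g : Matrix (Fin q) (Fin q) ℂ) (z : ℂ) :
    H * (bshift q n)ᴴ * RTs q n z + RT q n z * (vq q n * g - u) * (vq q n)ᴴ * RTs q n z =
    RT q n z * (H * (bshift q n)ᴴ - u * (vq q n)ᴴ - z • (bshift q n * H * (bshift q n)ᴴ)) *
      RTs q n z + Ecol q n z * g * (Ecol q n (conj z))ᴴ := by
  rw [← RT_vq, ← vq_RTs]
  have h : H * (bshift q n)ᴴ * RTs q n z =
      RT q n z * (1 - z • bshift q n) * (H * (bshift q n)ᴴ * RTs q n z) := by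
    rw [RT_mul, Matrix.one_mul]
  rw [h]
  simp only [Matrix.mul_sub, Matrix.sub_mul, Matrix.mul_one, Matrix.mul_smul, Matrix.smul_mul,
    Matrix.mul_assoc]
  abel

theorem mul_bshiftH_apply (q n : ℕ) (s : ℕ → Matrix (Fin q) (Fin q) ℂ)
    (j k : Fin (n + 1) × Fin q) :
    (hank q n s * (bshift q n)ᴴ) j k =
      if k.1.val = 0 then 0 else s (j.1.val + (k.1.val - 1)) j.2 k.2 := by
  rw [Matrix.mul_apply]
  by_cases h : k.1.val = 0
  · rw [if_pos h]
    apply Finset.sum_eq_zero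
    intro b _
    simp [bshift, h]
  · rw [if_neg h, Finset.sum_eq_single
      ((⟨k.1.val - 1, by have := k.1.isLt; omega⟩ : Fin (n + 1)), k.2)]
    · have : k.1.val = k.1.val - 1 + 1 := by omega
      simp only [bshift, hank, Matrix.conjTranspose_apply, Matrix.of_apply]
      rw [if_pos ⟨this, trivial⟩]
      simp
    · rintro ⟨b1, b2⟩ - hb
      simp only [bshift, Matrix.conjTranspose_apply, Matrix.of_apply]
      rw [if_neg]
      · simp
      · rintro ⟨h1, h2⟩
        apply hb
        exact Prod.ext (Fin.ext (by simp only; omega)) h2.symm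
    · simp

theorem mul_vqH_apply (q n : ℕ) (u : Matrix (Fin (n + 1) × Fin q) (Fin q) ℂ)
    (j k : Fin (n + 1) × Fin q) :
    (u * (vq q n)ᴴ) j k = if k.1.val = 0 then u j k.2 else 0 := by
  rw [Matrix.mul_apply, Finset.sum_eq_single k.2]
  · simp only [vq, Matrix.conjTranspose_apply, Matrix.of_apply, and_true]
    split_ifs <;> simp
  · intro b _ hb
    simp only [vq, Matrix.conjTranspose_apply, Matrix.of_apply]
    rw [if_neg fun h => hb h.2.symm]
    simp
  · simp

theorem herm_entry {q : ℕ} {A : Matrix (Fin q) (Fin q) ℂ} (h : Aᴴ = A) (a b : Fin q) :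
    star (A a b) = A b a := by
  rw [← Matrix.conjTranspose_apply, h]

/-- An explicit block form with first block `r` and Hankel blocks otherwise is Hermitian. -/
theorem herm_core (q n : ℕ) (s : ℕ → Matrix (Fin q) (Fin q) ℂ) (r : Matrix (Fin q) (Fin q) ℂ)
    (hs : ∀ j, j + 1 ≤ 2 * n → (s j)ᴴ = s j) (hr : rᴴ = r)
    (A : Matrix (Fin (n + 1) × Fin q) (Fin (n + 1) × Fin q) ℂ)
    (hA : ∀ j k, A j k = if j.1.val + k.1.val = 0 then r j.2 k.2 else
      s (j.1.val + k.1.val - 1) j.2 k.2) : Aᴴ = A := by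
  ext j k
  rw [Matrix.conjTranspose_apply, hA, hA, add_comm k.1.val]
  have := j.1.isLt
  have := k.1.isLt
  split_ifs with h
  · exact herm_entry hr _ _
  · exact herm_entry (hs _ (by omega)) _ _

theorem herm_B (q n : ℕ) (s : ℕ → Matrix (Fin q) (Fin q) ℂ)
    (hs : ∀ j ≤ 2 * n, (s j)ᴴ = s j) :
    (bshift q n * hank q n s * (bshift q n)ᴴ)ᴴ = bshift q n * hank q n s * (bshift q n)ᴴ := by
  have hH : (hank q n s)ᴴ = hank q n s := by
    ext j k
    have := j.1.isLt
    have := k.1.isLt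
    simp only [Matrix.conjTranspose_apply, hank, Matrix.of_apply]
    rw [add_comm k.1.val]
    exact herm_entry (hs _ (by omega)) _ _
  simp only [Matrix.conjTranspose_mul, Matrix.conjTranspose_conjTranspose, hH, Matrix.mul_assoc]

theorem herm_Aeven (q n : ℕ) (s : ℕ → Matrix (Fin q) (Fin q) ℂ)
    (hs : ∀ j ≤ 2 * n, (s j)ᴴ = s j) :
    (hank q n s * (bshift q n)ᴴ - uq q n s * (vq q n)ᴴ)ᴴ =
      hank q n s * (bshift q n)ᴴ - uq q n s * (vq q n)ᴴ := by
  refine herm_core q n s 0 (fun j hj => hs j (by omega)) (by simp) _ fun j k => ?_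
  rw [Matrix.sub_apply, mul_bshiftH_apply, mul_vqH_apply]
  simp only [uq, Matrix.of_apply]
  by_cases hk : k.1.val = 0
  · by_cases hj : j.1.val = 0 <;> simp [hk, hj]
  · have : j.1.val + (k.1.val - 1) = j.1.val + k.1.val - 1 := by omega
    rw [if_neg hk, if_neg hk, if_neg (by omega), this, sub_zero]

theorem herm_shift {q : ℕ} (α : ℝ) (s : ℕ → Matrix (Fin q) (Fin q) ℂ) (m : ℕ)
    (hs : ∀ j ≤ m + 1, (s j)ᴴ = s j) : ∀ j ≤ m, (sShift α s j)ᴴ = sShift α s j := by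
  intro j hj
  simp [sShift, Matrix.conjTranspose_smul, hs j (by omega), hs (j + 1) (by omega)]

theorem herm_Aodd (q n : ℕ) (α : ℝ) (s : ℕ → Matrix (Fin q) (Fin q) ℂ)
    (hs : ∀ j ≤ 2 * n + 1, (s j)ᴴ = s j) :
    (hank q n (sShift α s) * (bshift q n)ᴴ -
      ((-(α : ℂ)) • uq q n s - yq q n s) * (vq q n)ᴴ)ᴴ =
      hank q n (sShift α s) * (bshift q n)ᴴ -
      ((-(α : ℂ)) • uq q n s - yq q n s) * (vq q n)ᴴ := by
  refine herm_core q n (sShift α s) (s 0)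
    (fun j hj => herm_shift α s (2 * n) hs j (by omega)) (hs 0 (by omega)) _ fun j k => ?_
  rw [Matrix.sub_apply, mul_bshiftH_apply, mul_vqH_apply]
  simp only [uq, yq, Matrix.of_apply, Matrix.sub_apply, Matrix.smul_apply]
  by_cases hk : k.1.val = 0
  · by_cases hj : j.1.val = 0
    · simp [hk, hj]
    · have : j.1.val - 1 + 1 = j.1.val := by omega
      simp [hk, hj, sShift, this]
      ring
  · have : j.1.val + (k.1.val - 1) = j.1.val + k.1.val - 1 := by omega
    rw [if_neg hk, if_neg hk, if_neg (by omega), this, sub_zero]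

/-- Lemma (Mi,L3.5): decomposition of `F_{2n}` and `F_{2n+1}` into a Hermitian-on-`ℝ` matrix
polynomial part `Ψ` plus the term `E_{q,n}(z)·f(z)·E_{q,n}(conj z)*` (resp. with
`(z-α)·f(z)`). -/
theorem F_matrices_decompose_with_matrix_polynomials
    (q : ℕ) (hq : 1 ≤ q) (α : ℝ) (κ : ℕ)
    (s : ℕ → Matrix (Fin q) (Fin q) ℂ) (hs : ∀ j ≤ κ, (s j)ᴴ = s j)
    (f : ℂ → Matrix (Fin q) (Fin q) ℂ) :
    (∀ n : ℕ, 2 * n ≤ κ →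
      (∃ (N : ℕ) (C : ℕ → Matrix (Fin (n + 1) × Fin q) (Fin (n + 1) × Fin q) ℂ),
          ∀ z : ℂ, Psieven q n s z = ∑ j ∈ Finset.range (N + 1), z ^ j • C j) ∧
      Continuous (Psieven q n s) ∧
      (∀ x : ℝ, (Psieven q n s (x : ℂ))ᴴ = Psieven q n s (x : ℂ)) ∧
      (∀ z : ℂ, 0 < z.im →
        Feven q n s f z = Psieven q n s z + Ecol q n z * f z * (Ecol q n (conj z))ᴴ)) ∧
    (∀ n : ℕ, 2 * n + 1 ≤ κ →
      (∃ (N : ℕ) (C : ℕ → Matrix (Fin (n + 1) × Fin q) (Fin (n + 1) × Fin q) ℂ),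
          ∀ z : ℂ, Psiodd q n α s z = ∑ j ∈ Finset.range (N + 1), z ^ j • C j) ∧
      Continuous (Psiodd q n α s) ∧
      (∀ x : ℝ, (Psiodd q n α s (x : ℂ))ᴴ = Psiodd q n α s (x : ℂ)) ∧
      (∀ z : ℂ, 0 < z.im →
        Fodd q n α s f z =
          Psiodd q n α s z + Ecol q n z * ((z - (α : ℂ)) • f z) * (Ecol q n (conj z))ᴴ)) := by
  refine ⟨fun n hn => ⟨poly_exists q n _ _, poly_cont q n _ _, fun x => ?_, fun z _ => ?_⟩,
    fun n hn => ⟨poly_exists q n _ _, poly_cont q n _ _, fun x => ?_, fun z _ => ?_⟩⟩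
  · exact herm_gen q n _ _ (herm_Aeven q n s fun j hj => hs j (by omega))
      (herm_B q n s fun j hj => hs j (by omega)) x
  · exact decomp_gen q n _ _ _ z
  · exact herm_gen q n _ _ (herm_Aodd q n α s fun j hj => hs j (by omega))
      (herm_B q n _ (herm_shift α s (2 * n) fun j hj => hs j (by omega))) x
  · exact decomp_gen q n _ _ _ z
end

section
/- Let q ≥ 1 and n ∈ ℕ, and let (s_j)_{j=0}^{2n} ∈ H≥,e_{q,2n}. Then T_{q,n}*(D_n) ⊆ D_n, 𝔙_{q,n}*(D_n) ⊆ D_{n−1}, and V_{q,n}*(D_n) ⊆ D_{n−1}, where V_{q,n} := [δ_{j,k}·I_q] (j = 0,…,n; k = 0,…,n−1) and 𝔙_{q,n} := [δ_{j,k+1}·I_q] (j = 0,…,n; k = 0,…,n−1) are the (n+1)q × nq block matrices embedding ℂ^{nq} into the first, respectively last, n block components, and M(D) denotes the image of a subspace D under multiplication by the matrix M. -/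
open Matrix ComplexConjugate
open scoped ComplexOrder

noncomputable section

open scoped Classical in
/-- The Moore–Penrose inverse of a complex matrix (it exists and is unique,
so the `dite` below always takes its first branch and picks it out). -/
def mp {m n : Type*} [Fintype m] [Fintype n] (A : Matrix m n ℂ) : Matrix n m ℂ :=
  if h : ∃ X : Matrix n m ℂ,
      A * X * A = A ∧ X * A * X = X ∧ (A * X)ᴴ = A * X ∧ (X * A)ᴴ = X * A
  then h.choose else 0

/-- The Schur complements `L_0 = s_0` and
`L_j = s_{2j} - z_{j,2j-1}·(H_{j-1})^†·y_{j,2j-1}` for `j ≥ 1`. -/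
def LS (q : ℕ) (s : ℕ → Matrix (Fin q) (Fin q) ℂ) : ℕ → Matrix (Fin q) (Fin q) ℂ
  | 0 => s 0
  | n + 1 =>
      s (2 * (n + 1)) -
        (Matrix.of fun (a : Fin q) (j : Fin (n + 1) × Fin q) => s ((n + 1) + j.1.val) a j.2) *
          mp (hank q n s) *
          (Matrix.of fun (j : Fin (n + 1) × Fin q) (b : Fin q) => s ((n + 1) + j.1.val) j.2 b)

/-- The block diagonal matrix `diag(L_0, …, L_n)`. -/
def Ldiag (q n : ℕ) (s : ℕ → Matrix (Fin q) (Fin q) ℂ) :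
    Matrix (Fin (n + 1) × Fin q) (Fin (n + 1) × Fin q) ℂ :=
  Matrix.of fun j k => if j.1 = k.1 then LS q s j.1.val j.2 k.2 else 0

/-- The subspace `D_n = range(diag(L_0, …, L_n)) ⊆ ℂ^{(n+1)q}`. -/
def Dsub (q n : ℕ) (s : ℕ → Matrix (Fin q) (Fin q) ℂ) :
    Submodule ℂ (Fin (n + 1) × Fin q → ℂ) :=
  LinearMap.range (Matrix.mulVecLin (Ldiag q n s))

/-- `V_{q,n+1} = [δ_{j,k}·I_q]`, embedding `ℂ^{(n+1)q}` into the first `n+1` block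
components of `ℂ^{(n+2)q}` (defined here with `n+1` block columns). -/
def embV (q n : ℕ) : Matrix (Fin (n + 1) × Fin q) (Fin n × Fin q) ℂ :=
  Matrix.of fun j k => if j.1.val = k.1.val ∧ j.2 = k.2 then (1 : ℂ) else 0

/-- `𝔙_{q,n+1} = [δ_{j,k+1}·I_q]`, embedding `ℂ^{(n+1)q}` into the last `n+1` block
components of `ℂ^{(n+2)q}` (defined here with `n+1` block columns). -/
def embW (q n : ℕ) : Matrix (Fin (n + 1) × Fin q) (Fin n × Fin q) ℂ :=
  Matrix.of fun j k => if j.1.val = k.1.val + 1 ∧ j.2 = k.2 then (1 : ℂ) else 0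

end


theorem herm_pinv {m : Type*} [Fintype m] [DecidableEq m] (A : Matrix m m ℂ)
    (hA : A.IsHermitian) : ∃ X : Matrix m m ℂ,
      A * X * A = A ∧ X * A * X = X ∧ (A * X)ᴴ = A * X ∧ (X * A)ᴴ = X * A := by
  obtain ⟨U, V, d, hUV, hVU, hV, hAe⟩ : ∃ (U V : Matrix m m ℂ) (d : m → ℝ), U * V = 1 ∧ V * U = 1 ∧
      Uᴴ = V ∧ A = U * Matrix.diagonal (fun i => (d i : ℂ)) * V := by
    refine ⟨(hA.eigenvectorUnitary : Matrix m m ℂ), star (hA.eigenvectorUnitary : Matrix m m ℂ),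
      hA.eigenvalues, ?_, ?_, rfl, ?_⟩
    · exact (Matrix.mem_unitaryGroup_iff).1 hA.eigenvectorUnitary.2
    · exact (Matrix.mem_unitaryGroup_iff').1 hA.eigenvectorUnitary.2
    · exact hA.spectral_theorem
  have hV2 : Vᴴ = U := by rw [← hV, conjTranspose_conjTranspose]
  have key : ∀ D E : Matrix m m ℂ, (U * D * V) * (U * E * V) = U * (D * E) * V := by
    intro D E
    calc (U * D * V) * (U * E * V) = U * D * (V * U) * E * V := by simp only [Matrix.mul_assoc]
      _ = _ := by rw [hVU]; simp only [Matrix.mul_assoc, Matrix.one_mul]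
  refine ⟨U * Matrix.diagonal (fun i => ((d i)⁻¹ : ℂ)) * V, ?_, ?_, ?_, ?_⟩
  · rw [hAe, key, key, Matrix.diagonal_mul_diagonal, Matrix.diagonal_mul_diagonal]
    congr 3; ext i
    by_cases h : (d i : ℂ) = 0
    · simp [h]
    · field_simp
  · rw [hAe, key, key, Matrix.diagonal_mul_diagonal, Matrix.diagonal_mul_diagonal]
    congr 3; ext i
    by_cases h : (d i : ℂ) = 0
    · simp [h]
    · field_simp
  · rw [hAe, key, Matrix.diagonal_mul_diagonal]
    simp only [conjTranspose_mul, hV, hV2, Matrix.diagonal_conjTranspose, Matrix.mul_assoc]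
    congr 3; ext i; simp
  · rw [hAe, key, Matrix.diagonal_mul_diagonal]
    simp only [conjTranspose_mul, hV, hV2, Matrix.diagonal_conjTranspose, Matrix.mul_assoc]
    congr 3; ext i; simp

theorem mp_spec {m : Type*} [Fintype m] [DecidableEq m] (A : Matrix m m ℂ)
    (hA : A.IsHermitian) : A * mp A * A = A := by
  have h := herm_pinv A hA
  unfold mp
  rw [dif_pos h]
  exact h.choose_spec.1

theorem ker_factor {m k : Type*} [Fintype m] [DecidableEq m] (A X : Matrix m m ℂ)
    (hX : A * X * A = A) (B : Matrix k m ℂ)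
    (h : ∀ x, A *ᵥ x = 0 → B *ᵥ x = 0) : B = B * X * A := by
  have h1 : ∀ x, B *ᵥ (x - (X * A) *ᵥ x) = 0 := fun x => by
    apply h
    rw [Matrix.mulVec_sub, Matrix.mulVec_mulVec, ← Matrix.mul_assoc, hX, sub_self]
  apply Matrix.ext_of_mulVec_single
  intro i
  have := h1 (Pi.single i 1)
  rw [Matrix.mulVec_sub, Matrix.mulVec_mulVec, ← Matrix.mul_assoc, sub_eq_zero] at this
  exact this

/-- Block row `a` of a Hankel matrix applied to a vector. -/
def rowS {q : ℕ} (t : ℕ → Matrix (Fin q) (Fin q) ℂ) (m : ℕ) (v : ℕ → Fin q → ℂ) (a : ℕ) :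
    Fin q → ℂ := ∑ b ∈ Finset.range (m + 1), t (a + b) *ᵥ v b

theorem rowS_fin {q : ℕ} (t : ℕ → Matrix (Fin q) (Fin q) ℂ) (m : ℕ) (v : ℕ → Fin q → ℂ) (a : ℕ)
    (i : Fin q) : rowS t m v a i = ∑ p : Fin (m + 1) × Fin q, t (a + p.1.val) i p.2 * v p.1.val p.2 := by
  rw [rowS, Finset.sum_range, Finset.sum_apply, Fintype.sum_prod_type]
  rfl

theorem hank_mulVec {q : ℕ} (t : ℕ → Matrix (Fin q) (Fin q) ℂ) (m : ℕ) (v : ℕ → Fin q → ℂ)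
    (p : Fin (m + 1) × Fin q) :
    (hank q m t *ᵥ (fun p => v p.1.val p.2)) p = rowS t m v p.1.val p.2 := by
  rw [rowS_fin]; rfl

theorem rowS_trunc {q : ℕ} (t : ℕ → Matrix (Fin q) (Fin q) ℂ) (m M : ℕ) (hm : m ≤ M)
    (v : ℕ → Fin q → ℂ) (a : ℕ) :
    rowS t M (fun b => if b ≤ m then v b else 0) a = rowS t m v a := by
  unfold rowS
  rw [← Finset.sum_subset (s₁ := Finset.range (m + 1))]
  · apply Finset.sum_congr rfl
    intro b hb
    simp only
    rw [if_pos (by simp at hb; omega)]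
  · intro b hb; simp at hb ⊢; omega
  · intro b _ hb
    simp only
    rw [if_neg (by simp at hb; omega), Matrix.mulVec_zero]

theorem rowS_ker {q : ℕ} (t : ℕ → Matrix (Fin q) (Fin q) ℂ) (m M : ℕ) (hm : m ≤ M)
    (hM : (hank q M t).PosSemidef) (v : ℕ → Fin q → ℂ) (h : ∀ a ≤ m, rowS t m v a = 0) :
    ∀ a ≤ M, rowS t m v a = 0 := by
  set w : ℕ → Fin q → ℂ := fun b => if b ≤ m then v b else 0 with hw
  have h0 : hank q M t *ᵥ (fun p => w p.1.val p.2) = 0 := by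
    rw [← hM.dotProduct_mulVec_zero_iff]
    apply Finset.sum_eq_zero
    intro p _
    rw [hank_mulVec, hw, rowS_trunc t m M hm]
    by_cases hp : p.1.val ≤ m
    · rw [h _ hp]; simp
    · simp [hp]
  intro a ha
  ext i
  have := congrFun h0 (⟨a, by omega⟩, i)
  rw [hank_mulVec, hw, rowS_trunc t m M hm] at this
  exact this

theorem hank_herm_s9 {q : ℕ} (t : ℕ → Matrix (Fin q) (Fin q) ℂ) (M : ℕ)
    (hM : (hank q M t).IsHermitian) (k : ℕ) (hk : k ≤ 2 * M) : (t k)ᴴ = t k := by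
  ext i j
  have := congrFun (congrFun hM (⟨k / 2, by omega⟩, i)) (⟨k - k / 2, by omega⟩, j)
  simp only [hank, conjTranspose_apply, Matrix.of_apply] at this ⊢
  rw [show k - k / 2 + k / 2 = k by omega, show k / 2 + (k - k / 2) = k by omega] at this
  exact this

theorem hank_herm' {q : ℕ} (t : ℕ → Matrix (Fin q) (Fin q) ℂ) (M : ℕ)
    (hM : (hank q M t).IsHermitian) (m : ℕ) (hm : m ≤ M) : (hank q m t).IsHermitian := by
  ext ⟨a, i⟩ ⟨b, j⟩
  have := hank_herm_s9 t M hM (a.val + b.val) (by omega)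
  have := congrFun (congrFun this i) j
  simp only [hank, conjTranspose_apply, Matrix.of_apply] at this ⊢
  rw [add_comm]; exact this

theorem schur_W {q : ℕ} (t : ℕ → Matrix (Fin q) (Fin q) ℂ) (M : ℕ)
    (hM : (hank q M t).PosSemidef) (j : ℕ) (hj : j + 1 ≤ M) :
    ∃ W : Matrix (Fin (j + 1) × Fin q) (Fin q) ℂ,
      hank q j t * W = (Matrix.of fun (p : Fin (j + 1) × Fin q) (b : Fin q) => t ((j + 1) + p.1.val) p.2 b) ∧
      LS q t (j + 1) = t (2 * (j + 1)) -
        (Matrix.of fun (a : Fin q) (p : Fin (j + 1) × Fin q) => t ((j + 1) + p.1.val) a p.2) * W ∧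
      (LS q t (j + 1))ᴴ = LS q t (j + 1) := by
  have hH := hank_herm' t M hM.1 j (by omega)
  have hX := mp_spec _ hH
  set H := hank q j t with hHd
  set X := mp H
  set z : Matrix (Fin q) (Fin (j + 1) × Fin q) ℂ :=
    Matrix.of fun a p => t ((j + 1) + p.1.val) a p.2 with hz
  set y : Matrix (Fin (j + 1) × Fin q) (Fin q) ℂ :=
    Matrix.of fun p b => t ((j + 1) + p.1.val) p.2 b with hy
  have hzy : zᴴ = y := by
    ext p b
    have := congrFun (congrFun (hank_herm_s9 t M hM.1 (j + 1 + p.1.val) (by omega)) p.2) b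
    exact this
  have hyz : yᴴ = z := by rw [← hzy, conjTranspose_conjTranspose]
  have hker : ∀ x, H *ᵥ x = 0 → z *ᵥ x = 0 := by
    intro x hx
    let v : ℕ → Fin q → ℂ := fun b i => if h : b < j + 1 then x (⟨b, h⟩, i) else 0
    have hv : (fun p : Fin (j + 1) × Fin q => v p.1.val p.2) = x := by
      ext p; exact dif_pos p.1.isLt
    have := rowS_ker t j M (by omega) hM v (by
      intro a ha
      ext i
      have := hank_mulVec t j v (⟨a, by omega⟩, i)
      rw [hv, ← hHd, hx] at this
      exact this.symm) (j + 1) hj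
    ext i
    have h2 := congrFun this i
    rw [rowS_fin] at h2
    rw [← hv]
    exact h2
  have hf := ker_factor H X hX z hker
  have hHW : H * (Xᴴ * y) = y := by
    have := congrArg conjTranspose hf
    rw [conjTranspose_mul, conjTranspose_mul, hzy, hH.eq] at this
    exact this.symm
  have hL : LS q t (j + 1) = t (2 * (j + 1)) - z * (Xᴴ * y) := by
    have : LS q t (j + 1) = t (2 * (j + 1)) - z * X * y := rfl
    rw [this]
    congr 1
    conv_lhs => rw [← hHW, ← Matrix.mul_assoc, ← hf]
  refine ⟨Xᴴ * y, hHW, hL, ?_⟩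
  rw [hL]
  set W := Xᴴ * y
  have hzW : z = Wᴴ * H := by rw [← hyz, ← hHW, conjTranspose_mul, hH.eq]
  rw [conjTranspose_sub, hank_herm_s9 t M hM.1 _ (by omega), hzW]
  simp only [conjTranspose_mul, hH.eq, conjTranspose_conjTranspose, Matrix.mul_assoc]

theorem LS_ker_iff {q : ℕ} (t : ℕ → Matrix (Fin q) (Fin q) ℂ) (M : ℕ)
    (hM : (hank q M t).PosSemidef) (j : ℕ) (hj : j ≤ M) (x : Fin q → ℂ) :
    LS q t j *ᵥ x = 0 ↔ ∃ v : ℕ → Fin q → ℂ, v j = x ∧ ∀ a ≤ j, rowS t j v a = 0 := by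
  cases j with
  | zero =>
    constructor
    · intro h
      refine ⟨fun _ => x, rfl, fun a ha => ?_⟩
      obtain rfl : a = 0 := by omega
      simpa [rowS, LS] using h
    · rintro ⟨v, rfl, h⟩
      simpa [rowS, LS] using h 0 le_rfl
  | succ j =>
    obtain ⟨W, hW, hL, -⟩ := schur_W t M hM j hj
    let w : ℕ → Fin q → ℂ := fun b i => if h : b < j + 1 then (W *ᵥ x) (⟨b, h⟩, i) else 0
    have hw : (fun p : Fin (j + 1) × Fin q => w p.1.val p.2) = W *ᵥ x := by
      ext p; exact dif_pos p.1.isLt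
    have hwH : ∀ a ≤ j, rowS t j w a = t (a + (j + 1)) *ᵥ x := by
      intro a ha
      ext i
      have := hank_mulVec t j w (⟨a, by omega⟩, i)
      rw [hw, Matrix.mulVec_mulVec, hW] at this
      rw [add_comm a (j + 1)]
      refine this.symm.trans ?_
      rfl
    have hwz : LS q t (j + 1) *ᵥ x = t (j + 1 + (j + 1)) *ᵥ x - rowS t j w (j + 1) := by
      rw [hL, Matrix.sub_mulVec, ← Matrix.mulVec_mulVec, ← hw, two_mul]
      congr 1
      ext i
      rw [rowS_fin]
      rfl
    have hsucc : ∀ v a, rowS t (j + 1) v a = rowS t j v a + t (a + (j + 1)) *ᵥ v (j + 1) :=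
      fun v a => Finset.sum_range_succ _ _
    constructor
    · intro h
      rw [hwz] at h
      refine ⟨fun b => if b ≤ j then - w b else x, by simp, fun a ha => ?_⟩
      have : rowS t j (fun b => if b ≤ j then - w b else x) a = - rowS t j w a := by
        unfold rowS
        rw [← Finset.sum_neg_distrib]
        apply Finset.sum_congr rfl
        intro b hb
        simp only
        rw [if_pos (by simp at hb; omega), Matrix.mulVec_neg]
      rw [hsucc, this]
      rcases Nat.lt_or_ge j a with h1 | h1
      · obtain rfl : a = j + 1 := by omega
        simp only [show ¬ (j + 1 ≤ j) by omega, if_false]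
        rw [← h]; abel
      · rw [hwH a h1]; simp
    · rintro ⟨v, rfl, h⟩
      have hadd : ∀ a, rowS t j (v + w) a = rowS t j v a + rowS t j w a := by
        intro a
        unfold rowS
        rw [← Finset.sum_add_distrib]
        exact Finset.sum_congr rfl fun b _ => Matrix.mulVec_add _ _ _
      have := rowS_ker t j M (by omega) hM (v + w) (fun a ha => by
        rw [hadd, hwH a ha, ← hsucc]; exact h a (by omega)) (j + 1) hj
      rw [hadd] at this
      have h3 := h (j + 1) le_rfl
      rw [hsucc] at h3
      rw [hwz, eq_neg_of_add_eq_zero_right this, sub_neg_eq_add, add_comm]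
      exact h3

theorem LS_ker_mono {q : ℕ} (t : ℕ → Matrix (Fin q) (Fin q) ℂ) (M : ℕ)
    (hM : (hank q M t).PosSemidef) (j : ℕ) (hj : j + 2 ≤ M) (x : Fin q → ℂ)
    (h : LS q t j *ᵥ x = 0) : LS q t (j + 1) *ᵥ x = 0 := by
  rw [LS_ker_iff t M hM _ (by omega)] at h ⊢
  obtain ⟨v, hv, h⟩ := h
  refine ⟨fun b => match b with | 0 => 0 | k + 1 => v k, hv, fun a ha => ?_⟩
  refine Eq.trans ?_ (rowS_ker t j M (by omega) hM v h (a + 1) (by omega))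
  unfold rowS
  rw [Finset.sum_range_succ']
  simp only [Matrix.mulVec_zero, add_zero]
  apply Finset.sum_congr rfl
  intro b _
  rw [show a + (b + 1) = a + 1 + b by omega]

theorem LS_herm {q : ℕ} (t : ℕ → Matrix (Fin q) (Fin q) ℂ) (M : ℕ)
    (hM : (hank q M t).PosSemidef) (j : ℕ) (hj : j ≤ M) : (LS q t j)ᴴ = LS q t j := by
  cases j with
  | zero => exact hank_herm_s9 t M hM.1 0 (by omega)
  | succ j => obtain ⟨W, -, -, h⟩ := schur_W t M hM j hj; exact h

theorem LS_range {q : ℕ} (t : ℕ → Matrix (Fin q) (Fin q) ℂ) (M : ℕ)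
    (hM : (hank q M t).PosSemidef) (j : ℕ) (hj : j + 2 ≤ M) :
    ∃ C, LS q t (j + 1) = LS q t j * C := by
  have hA := LS_herm t M hM j (by omega)
  have hB := LS_herm t M hM (j + 1) (by omega)
  obtain ⟨X, hX, -⟩ := herm_pinv _ hA
  have := congrArg conjTranspose (ker_factor _ X hX _ (LS_ker_mono t M hM j hj))
  rw [hB, conjTranspose_mul, hA] at this
  exact ⟨_, this⟩

theorem LS_congr {q : ℕ} (s t : ℕ → Matrix (Fin q) (Fin q) ℂ) (j : ℕ)
    (h : ∀ k ≤ 2 * j, t k = s k) : LS q t j = LS q s j := by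
  cases j with
  | zero => exact h 0 (by omega)
  | succ j =>
    have hH : hank q j t = hank q j s := by
      ext p r
      simp only [hank, Matrix.of_apply]
      rw [h _ (by omega)]
    have h1 : (Matrix.of fun (a : Fin q) (p : Fin (j + 1) × Fin q) => t ((j + 1) + p.1.val) a p.2) =
        (Matrix.of fun (a : Fin q) (p : Fin (j + 1) × Fin q) => s ((j + 1) + p.1.val) a p.2) := by
      ext a p
      simp only [Matrix.of_apply]
      rw [h _ (by omega)]
    have h2 : (Matrix.of fun (p : Fin (j + 1) × Fin q) (a : Fin q) => t ((j + 1) + p.1.val) p.2 a) =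
        (Matrix.of fun (p : Fin (j + 1) × Fin q) (a : Fin q) => s ((j + 1) + p.1.val) p.2 a) := by
      ext p a
      simp only [Matrix.of_apply]
      rw [h _ (by omega)]
    simp only [LS]
    rw [hH, h _ le_rfl, h1, h2]

theorem Ldiag_mulVec {q : ℕ} (n : ℕ) (s : ℕ → Matrix (Fin q) (Fin q) ℂ)
    (x : Fin (n + 1) × Fin q → ℂ) (k : Fin (n + 1)) (i : Fin q) :
    (Ldiag q n s *ᵥ x) (k, i) = (LS q s k.val *ᵥ fun i => x (k, i)) i := by
  simp only [Matrix.mulVec, dotProduct, Fintype.sum_prod_type, Ldiag, Matrix.of_apply, ite_mul,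
    zero_mul]
  rw [Finset.sum_eq_single k]
  · simp
  · intro b _ hb; simp [hb.symm]
  · simp

theorem mem_Dsub {q : ℕ} (n : ℕ) (s : ℕ → Matrix (Fin q) (Fin q) ℂ)
    (x : Fin (n + 1) × Fin q → ℂ) :
    x ∈ Dsub q n s ↔ ∀ k : Fin (n + 1), ∃ y, LS q s k.val *ᵥ y = fun i => x (k, i) := by
  constructor
  · rintro ⟨y, rfl⟩ k
    exact ⟨fun i => y (k, i), by ext i; exact (Ldiag_mulVec n s y k i).symm⟩
  · intro h
    choose y hy using h
    refine ⟨fun p => y p.1 p.2, ?_⟩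
    ext ⟨k, i⟩
    rw [Matrix.mulVecLin_apply, Ldiag_mulVec]
    exact congrFun (hy k) i

theorem sel_mulVec {q N m : ℕ} (B : Matrix (Fin N × Fin q) (Fin m × Fin q) ℂ) (f : ℕ → ℕ)
    (hB : ∀ j k, B j k = if j.1.val = f k.1.val ∧ j.2 = k.2 then (1 : ℂ) else 0)
    (x : Fin N × Fin q → ℂ) (k : Fin m) (i : Fin q) :
    (Bᴴ *ᵥ x) (k, i) = if h : f k.val < N then x (⟨f k.val, h⟩, i) else 0 := by
  simp only [Matrix.mulVec, dotProduct, conjTranspose_apply, hB]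
  split_ifs with h
  · rw [Finset.sum_eq_single (⟨f k.val, h⟩, i)]
    · simp
    · rintro ⟨a, b⟩ _ hb
      rw [if_neg]
      · simp
      · rintro ⟨h1, h2⟩
        apply hb
        ext
        · exact h1
        · exact congrArg _ h2
    · simp
  · apply Finset.sum_eq_zero
    rintro ⟨a, b⟩ _
    rw [if_neg]
    · simp
    · rintro ⟨h1, h2⟩
      simp only at h1
      omega

/-- Lemma (R1103): for a Hankel nonnegative definite extendable sequence `(s_j)_{j=0}^{2n}`
(with `n ≥ 1`, realized here as `n+1` for `n : ℕ`), the canonical subspace `D_n` satisfies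
`T_{q,n}*(D_n) ⊆ D_n`, `𝔙_{q,n}*(D_n) ⊆ D_{n-1}`, and `V_{q,n}*(D_n) ⊆ D_{n-1}`. -/
theorem canonical_subspace_shift_invariance
    (q : ℕ) (hq : 1 ≤ q) (n : ℕ) (s : ℕ → Matrix (Fin q) (Fin q) ℂ)
    (hext : ∃ t : ℕ → Matrix (Fin q) (Fin q) ℂ,
      (∀ j ≤ 2 * (n + 1), t j = s j) ∧ (hank q (n + 2) t).PosSemidef) :
    Submodule.map (Matrix.mulVecLin (bshift q (n + 1))ᴴ) (Dsub q (n + 1) s) ≤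
        Dsub q (n + 1) s ∧
    Submodule.map (Matrix.mulVecLin (embW q (n + 1))ᴴ) (Dsub q (n + 1) s) ≤ Dsub q n s ∧
    Submodule.map (Matrix.mulVecLin (embV q (n + 1))ᴴ) (Dsub q (n + 1) s) ≤ Dsub q n s := by
  obtain ⟨t, hts, hM⟩ := hext
  have hR : ∀ j ≤ n, ∃ C, LS q s (j + 1) = LS q s j * C := by
    intro j hj
    rw [← LS_congr s t (j + 1) fun k hk => hts k (by omega),
      ← LS_congr s t j fun k hk => hts k (by omega)]
    exact LS_range t (n + 2) hM j (by omega)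
  have hstep : ∀ x ∈ Dsub q (n + 1) s, ∀ (k : ℕ) (hk : k + 1 < n + 1 + 1),
      ∃ y, LS q s k *ᵥ y = fun i => x (⟨k + 1, hk⟩, i) := by
    intro x hx k hk
    obtain ⟨y, hy⟩ := (mem_Dsub _ _ _).1 hx ⟨k + 1, hk⟩
    obtain ⟨C, hC⟩ := hR k (by omega)
    refine ⟨C *ᵥ y, ?_⟩
    rw [Matrix.mulVec_mulVec, ← hC]
    exact hy
  refine ⟨?_, ?_, ?_⟩
  · rintro _ ⟨x, hx, rfl⟩
    rw [mem_Dsub]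
    intro k
    by_cases hk : k.val + 1 < n + 1 + 1
    · obtain ⟨y, hy⟩ := hstep x hx k.val hk
      refine ⟨y, hy.trans ?_⟩
      ext i
      rw [Matrix.mulVecLin_apply, sel_mulVec (bshift q (n + 1)) (fun k => k + 1) (fun _ _ => rfl), dif_pos hk]
    · refine ⟨0, ?_⟩
      ext i
      rw [Matrix.mulVecLin_apply, sel_mulVec (bshift q (n + 1)) (fun k => k + 1) (fun _ _ => rfl), dif_neg hk]
      simp
  · rintro _ ⟨x, hx, rfl⟩
    rw [mem_Dsub]
    intro k
    have hk : k.val + 1 < n + 1 + 1 := by omega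
    obtain ⟨y, hy⟩ := hstep x hx k.val hk
    refine ⟨y, hy.trans ?_⟩
    ext i
    rw [Matrix.mulVecLin_apply, sel_mulVec (embW q (n + 1)) (fun k => k + 1) (fun _ _ => rfl), dif_pos hk]
  · rintro _ ⟨x, hx, rfl⟩
    rw [mem_Dsub]
    intro k
    have hk : k.val < n + 1 + 1 := by omega
    obtain ⟨y, hy⟩ := (mem_Dsub _ _ _).1 hx ⟨k.val, hk⟩
    refine ⟨y, hy.trans ?_⟩
    ext i
    rw [Matrix.mulVecLin_apply, sel_mulVec (embV q (n + 1)) (fun k => k) (fun _ _ => rfl), dif_pos hk]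
end
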